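/- arXiv:1110.0708 — 2 statements merged into one kernel-verified Lean document; each statement's English description precedes it below -/
import Mathlib

section
/- Let (a_n) and (b_n) be defined by a_0 = 1, b_0 = √2, a_{n+1} = (a_n + b_n)/2, b_{n+1} = √(a_n · b_n). Then (a_n) and (b_n) converge to a common limit M(1,√2), and (L'/L)(1, χ_{−4}) = log( M(1,√2)² · e^γ / 2 ), where γ is the Euler–Mascheroni constant. -/
open Filter Real

/-- Lagrange's AGM iteration started from `(1, √2)`:
`a₀ = 1`, `b₀ = √2`, `a_{n+1} = (a_n + b_n)/2`, `b_{n+1} = √(a_n b_n)`. -/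
noncomputable def agm : ℕ → ℝ × ℝ
  | 0 => (1, Real.sqrt 2)
  | n + 1 => (((agm n).1 + (agm n).2) / 2, Real.sqrt ((agm n).1 * (agm n).2))

/-- The nontrivial Dirichlet character mod 4. -/
noncomputable def chi4 (n : ℕ) : ℝ :=
  if n % 4 = 1 then 1 else if n % 4 = 3 then -1 else 0

/-- The complete elliptic integral `∫ dt / √((t² + a²)(t² + b²))` over the real line. -/
noncomputable def ellipticIntegral (a b : ℝ) : ℝ :=
  ∫ t : ℝ, (√((t ^ 2 + a ^ 2) * (t ^ 2 + b ^ 2)))⁻¹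

lemma ellipticIntegral_eq_two_mul (a b : ℝ) :
    ellipticIntegral a b =
      2 * ∫ t in Set.Ioi (0 : ℝ), (√((t ^ 2 + a ^ 2) * (t ^ 2 + b ^ 2)))⁻¹ := by
  rw [ellipticIntegral, ← integral_comp_abs (f := fun t => (√((t ^ 2 + a ^ 2) * (t ^ 2 + b ^ 2)))⁻¹)]
  simp only [sq_abs]

lemma image_half_sub_div_Ioi {c : ℝ} (hc : 0 < c) :
    (fun t : ℝ => (t - c / t) / 2) '' Set.Ioi 0 = Set.univ := by
  refine Set.eq_univ_of_forall fun y => ?_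
  have hs : 0 < √(y ^ 2 + c) := Real.sqrt_pos.2 (by positivity)
  have hsq : √(y ^ 2 + c) ^ 2 = y ^ 2 + c := Real.sq_sqrt (by positivity)
  have hpos : 0 < y + √(y ^ 2 + c) := by
    have : |y| < √(y ^ 2 + c) := by
      rw [← Real.sqrt_sq_eq_abs]
      exact Real.sqrt_lt_sqrt (sq_nonneg y) (by linarith)
    linarith [neg_abs_le y]
  refine ⟨y + √(y ^ 2 + c), hpos, ?_⟩
  dsimp only
  field_simp
  linear_combination hsq

/-- Invariance of the elliptic integral under the arithmetic-geometric mean step. -/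
lemma ellipticIntegral_agm_step {a b : ℝ} (ha : 0 < a) (hb : 0 < b) :
    ellipticIntegral √(a * b) ((a + b) / 2) = ellipticIntegral a b := by
  have hc : 0 < a * b := mul_pos ha hb
  have hinj : Set.InjOn (fun t : ℝ => (t - a * b / t) / 2) (Set.Ioi 0) := by
    refine StrictMonoOn.injOn fun t ht s hs hts => ?_
    have : a * b / s < a * b / t := div_lt_div_of_pos_left hc ht hts
    linarith
  have hderiv : ∀ t ∈ Set.Ioi (0 : ℝ), HasDerivWithinAt (fun t : ℝ => (t - a * b / t) / 2)
      ((1 + a * b / t ^ 2) / 2) (Set.Ioi 0) t := by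
    intro t ht
    have h : HasDerivAt (fun t : ℝ => (t - a * b * t⁻¹) / 2)
        ((1 - a * b * -(t ^ 2)⁻¹) / 2) t :=
      ((hasDerivAt_id t).sub ((hasDerivAt_inv (ne_of_gt ht)).const_mul (a * b))).div_const 2
    exact (h.congr_deriv (by ring)).hasDerivWithinAt
  rw [ellipticIntegral, ← MeasureTheory.setIntegral_univ, ← image_half_sub_div_Ioi hc,
    MeasureTheory.integral_image_eq_integral_abs_deriv_smul measurableSet_Ioi hderiv hinj,
    ellipticIntegral_eq_two_mul, ← MeasureTheory.integral_const_mul]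
  refine MeasureTheory.setIntegral_congr_fun measurableSet_Ioi fun t (ht : 0 < t) => ?_
  have hP : 0 < √((t ^ 2 + a ^ 2) * (t ^ 2 + b ^ 2)) := Real.sqrt_pos.2 (by positivity)
  have hPsq := Real.sq_sqrt (show 0 ≤ (t ^ 2 + a ^ 2) * (t ^ 2 + b ^ 2) by positivity)
  have key : √((((t - a * b / t) / 2) ^ 2 + √(a * b) ^ 2) *
      (((t - a * b / t) / 2) ^ 2 + ((a + b) / 2) ^ 2)) =
      (t + a * b / t) / 2 * (√((t ^ 2 + a ^ 2) * (t ^ 2 + b ^ 2)) / (2 * t)) := by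
    rw [Real.sqrt_eq_iff_mul_self_eq (by positivity) (by positivity), Real.sq_sqrt hc.le]
    rw [← sq, mul_pow, div_pow (√_), hPsq]
    field_simp
    ring
  rw [key, abs_of_pos (by positivity), smul_eq_mul]
  field_simp

lemma integrable_inv_sq_add_sq {m : ℝ} (hm : 0 < m) :
    MeasureTheory.Integrable fun t : ℝ => (t ^ 2 + m ^ 2)⁻¹ := by
  have h := (integrable_inv_one_add_sq.comp_div hm.ne').const_mul (m ^ 2)⁻¹
  refine h.congr (Eventually.of_forall fun t => ?_)
  dsimp only
  field_simp
  ring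

lemma integral_univ_inv_sq_add_sq {m : ℝ} (hm : 0 < m) :
    ∫ t : ℝ, (t ^ 2 + m ^ 2)⁻¹ = π / m := by
  have h := MeasureTheory.Measure.integral_comp_div (fun t : ℝ => (1 + t ^ 2)⁻¹) m
  rw [integral_univ_inv_one_add_sq, abs_of_pos hm, smul_eq_mul] at h
  have h2 : ∀ t : ℝ, (t ^ 2 + m ^ 2)⁻¹ = (m ^ 2)⁻¹ * (1 + (t / m) ^ 2)⁻¹ := by
    intro t
    field_simp
    ring
  simp_rw [h2]
  rw [MeasureTheory.integral_const_mul, h]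
  field_simp

lemma inv_sqrt_mul_le {a b t : ℝ} (ha : 0 < a) (hab : a ≤ b) :
    (√((t ^ 2 + a ^ 2) * (t ^ 2 + b ^ 2)))⁻¹ ≤ (t ^ 2 + a ^ 2)⁻¹ := by
  refine inv_anti₀ (by positivity) (Real.le_sqrt_of_sq_le ?_)
  rw [sq (t ^ 2 + a ^ 2)]
  gcongr

lemma le_inv_sqrt_mul {a b t : ℝ} (ha : 0 < a) (hab : a ≤ b) :
    (t ^ 2 + b ^ 2)⁻¹ ≤ (√((t ^ 2 + a ^ 2) * (t ^ 2 + b ^ 2)))⁻¹ := by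
  have hb : 0 < b := ha.trans_le hab
  refine inv_anti₀ (Real.sqrt_pos.2 (by positivity)) (Real.sqrt_le_iff.2 ⟨by positivity, ?_⟩)
  rw [sq (t ^ 2 + b ^ 2)]
  gcongr

lemma integrable_inv_sqrt_mul {a b : ℝ} (ha : 0 < a) (hab : a ≤ b) :
    MeasureTheory.Integrable fun t : ℝ => (√((t ^ 2 + a ^ 2) * (t ^ 2 + b ^ 2)))⁻¹ := by
  refine (integrable_inv_sq_add_sq ha).mono' (by fun_prop) (Eventually.of_forall fun t => ?_)
  rw [Real.norm_of_nonneg (by positivity)]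
  exact inv_sqrt_mul_le ha hab

lemma ellipticIntegral_le {a b : ℝ} (ha : 0 < a) (hab : a ≤ b) :
    ellipticIntegral a b ≤ π / a := by
  rw [← integral_univ_inv_sq_add_sq ha]
  exact MeasureTheory.integral_mono (integrable_inv_sqrt_mul ha hab) (integrable_inv_sq_add_sq ha)
    fun t => inv_sqrt_mul_le ha hab

lemma le_ellipticIntegral {a b : ℝ} (ha : 0 < a) (hab : a ≤ b) :
    π / b ≤ ellipticIntegral a b := by
  rw [← integral_univ_inv_sq_add_sq (ha.trans_le hab)]
  exact MeasureTheory.integral_mono (integrable_inv_sq_add_sq (ha.trans_le hab))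
    (integrable_inv_sqrt_mul ha hab) fun t => le_inv_sqrt_mul ha hab

lemma agmSequences_fst_pos {x y : NNReal} (hx : 0 < x) (hy : 0 < y) (n : ℕ) :
    0 < (NNReal.agmSequences x y n).1 := by
  refine lt_of_lt_of_le ?_ (NNReal.agmSequences_fst_monotone (Nat.zero_le n))
  exact NNReal.sqrt_pos.2 (mul_pos hx hy)

lemma ellipticIntegral_agmSequences {x y : NNReal} (hx : 0 < x) (hy : 0 < y) (n : ℕ) :
    ellipticIntegral (NNReal.agmSequences x y n).1 (NNReal.agmSequences x y n).2 =
      ellipticIntegral x y := by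
  induction n with
  | zero =>
    rw [NNReal.agmSequences_zero, ← ellipticIntegral_agm_step (a := x) (b := y) hx hy]
    simp
  | succ n ih =>
    have h1 := agmSequences_fst_pos hx hy n
    have h2 := h1.trans_le (NNReal.agmSequences_fst_le_snd n n)
    have h := ellipticIntegral_agm_step (NNReal.coe_pos.2 h1) (NNReal.coe_pos.2 h2)
    rw [← ih, NNReal.agmSequences_succ', ← h]
    simp

/-- Gauss's formula for the arithmetic-geometric mean. -/
lemma ellipticIntegral_eq_pi_div_agm {x y : NNReal} (hx : 0 < x) (hy : 0 < y) :
    ellipticIntegral x y = π / (NNReal.agm x y : ℝ) := by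
  have hM : (NNReal.agm x y : ℝ) ≠ 0 := by exact_mod_cast (NNReal.agm_pos hx hy).ne'
  have hfst : Tendsto (fun n => π / ((NNReal.agmSequences x y n).1 : ℝ)) atTop
      (nhds (π / (NNReal.agm x y : ℝ))) :=
    tendsto_const_nhds.div ((NNReal.tendsto_coe).2 NNReal.tendsto_agmSequences_fst_agm) hM
  have hsnd : Tendsto (fun n => π / ((NNReal.agmSequences x y n).2 : ℝ)) atTop
      (nhds (π / (NNReal.agm x y : ℝ))) :=
    tendsto_const_nhds.div ((NNReal.tendsto_coe).2 NNReal.tendsto_agmSequences_snd_agm) hM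
  refine le_antisymm (ge_of_tendsto' hfst fun n => ?_) (le_of_tendsto' hsnd fun n => ?_)
  · rw [← ellipticIntegral_agmSequences hx hy n]
    exact ellipticIntegral_le (by exact_mod_cast agmSequences_fst_pos hx hy n)
      (by exact_mod_cast NNReal.agmSequences_fst_le_snd n n)
  · rw [← ellipticIntegral_agmSequences hx hy n]
    exact le_ellipticIntegral (by exact_mod_cast agmSequences_fst_pos hx hy n)
      (by exact_mod_cast NNReal.agmSequences_fst_le_snd n n)

lemma integral_rpow_mul_one_sub_rpow {α β : ℝ} (hα : 0 < α) (hβ : 0 < β) :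
    ∫ x in Set.Ioo (0 : ℝ) 1, x ^ (α - 1) * (1 - x) ^ (β - 1) =
      Real.Gamma α * Real.Gamma β / Real.Gamma (α + β) := by
  have h := ProbabilityTheory.beta_eq_betaIntegralReal α β hα hβ
  rw [ProbabilityTheory.beta, Complex.betaIntegral,
    intervalIntegral.integral_of_le zero_le_one, MeasureTheory.integral_Ioc_eq_integral_Ioo] at h
  rw [h, ← Complex.ofReal_re (∫ x in Set.Ioo (0 : ℝ) 1, x ^ (α - 1) * (1 - x) ^ (β - 1)),
    ← integral_complex_ofReal]
  congr 1
  refine MeasureTheory.setIntegral_congr_fun measurableSet_Ioo fun x hx => ?_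
  have h1 : 0 ≤ 1 - x := by linarith [hx.2]
  simp only [Complex.ofReal_mul, Complex.ofReal_cpow hx.1.le, Complex.ofReal_cpow h1]
  push_cast
  rfl

lemma Gamma_one_quarter_mul_Gamma_three_quarters :
    Real.Gamma (1 / 4) * Real.Gamma (3 / 4) = π * √2 := by
  have h := Real.Gamma_mul_Gamma_one_sub (1 / 4)
  rw [show π * (1 / 4) = π / 4 by ring, Real.sin_pi_div_four] at h
  rw [show (3 / 4 : ℝ) = 1 - 1 / 4 by norm_num, h]
  have h2 := Real.sq_sqrt (show (0 : ℝ) ≤ 2 by norm_num)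
  field_simp
  linarith

lemma ellipticIntegral_one_sqrt_two :
    ellipticIntegral 1 √2 = Real.Gamma (1 / 4) ^ 2 / (2 * √(2 * π)) := by
  have himage : (fun t : ℝ => ((t ^ 2 + 1) ^ 2)⁻¹) '' Set.Ioi 0 = Set.Ioo 0 1 := by
    ext y
    constructor
    · rintro ⟨t, ht : 0 < t, rfl⟩
      exact ⟨by positivity, inv_lt_one_of_one_lt₀ (by nlinarith [sq_nonneg (t ^ 2), pow_pos ht 2])⟩
    · rintro ⟨hy0, hy1⟩
      have h1 : 1 < √(y⁻¹) := by
        rw [Real.lt_sqrt zero_le_one, one_pow]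
        exact (one_lt_inv₀ hy0).2 hy1
      refine ⟨√(√(y⁻¹) - 1), Real.sqrt_pos.2 (by linarith), ?_⟩
      dsimp only
      rw [Real.sq_sqrt (by linarith), sub_add_cancel, Real.sq_sqrt (by positivity), inv_inv]
  have hinj : Set.InjOn (fun t : ℝ => ((t ^ 2 + 1) ^ 2)⁻¹) (Set.Ioi 0) := by
    refine StrictAntiOn.injOn fun t (ht : 0 < t) s (hs : 0 < s) hts => ?_
    gcongr
  have hderiv : ∀ t ∈ Set.Ioi (0 : ℝ), HasDerivWithinAt (fun t : ℝ => ((t ^ 2 + 1) ^ 2)⁻¹)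
      (-(4 * t / (t ^ 2 + 1) ^ 3)) (Set.Ioi 0) t := by
    intro t ht
    have hne : t ^ 2 + 1 ≠ 0 := by positivity
    have h := (((hasDerivAt_pow 2 t).add_const 1).fun_pow 2).fun_inv (pow_ne_zero 2 hne)
    refine (h.congr_deriv ?_).hasDerivWithinAt
    push_cast
    field_simp
    ring
  have hbeta := integral_rpow_mul_one_sub_rpow (α := 1 / 4) (β := 1 / 2) (by norm_num) (by norm_num)
  rw [← himage, MeasureTheory.integral_image_eq_integral_abs_deriv_smul measurableSet_Ioi hderiv
    hinj] at hbeta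
  have hcongr : ∫ t in Set.Ioi (0 : ℝ), |(-(4 * t / (t ^ 2 + 1) ^ 3))| •
      ((((t ^ 2 + 1) ^ 2)⁻¹) ^ ((1 / 4 : ℝ) - 1) * (1 - ((t ^ 2 + 1) ^ 2)⁻¹) ^ ((1 / 2 : ℝ) - 1)) =
      ∫ t in Set.Ioi (0 : ℝ), 4 * (√((t ^ 2 + 1 ^ 2) * (t ^ 2 + √2 ^ 2)))⁻¹ := by
    refine MeasureTheory.setIntegral_congr_fun measurableSet_Ioi fun t (ht : 0 < t) => ?_
    have hw : 0 < t ^ 2 + 1 := by positivity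
    have e1 : (((t ^ 2 + 1) ^ 2)⁻¹) ^ ((1 / 4 : ℝ) - 1) = (t ^ 2 + 1) * √(t ^ 2 + 1) := by
      rw [← Real.rpow_natCast, ← Real.rpow_neg hw.le, ← Real.rpow_mul hw.le, Real.sqrt_eq_rpow]
      nth_rewrite 2 [← Real.rpow_one (t ^ 2 + 1)]
      rw [← Real.rpow_add hw]
      norm_num
    have e2 : (1 - ((t ^ 2 + 1) ^ 2)⁻¹) ^ ((1 / 2 : ℝ) - 1) =
        (t ^ 2 + 1) / (t * √(t ^ 2 + 2)) := by
      have : 1 - ((t ^ 2 + 1) ^ 2)⁻¹ = (t * √(t ^ 2 + 2) / (t ^ 2 + 1)) ^ 2 := by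
        rw [div_pow, mul_pow, Real.sq_sqrt (by positivity)]
        field_simp
        ring
      rw [this, ← Real.rpow_natCast, ← Real.rpow_mul (by positivity)]
      norm_num
      rw [Real.rpow_neg_one, inv_div]
    have hs1 : 0 < √(t ^ 2 + 1) := Real.sqrt_pos.2 hw
    have hs2 : 0 < √(t ^ 2 + 2) := Real.sqrt_pos.2 (by positivity)
    have hsq := Real.sq_sqrt hw.le
    rw [e1, e2, abs_neg, abs_of_pos (by positivity), smul_eq_mul, one_pow,
      Real.sq_sqrt (by norm_num : (0 : ℝ) ≤ 2), Real.sqrt_mul hw.le]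
    field_simp
    rw [hsq]
  rw [hcongr, MeasureTheory.integral_const_mul] at hbeta
  have hG := Gamma_one_quarter_mul_Gamma_three_quarters
  have hpos : 0 < Real.Gamma (3 / 4) := Real.Gamma_pos_of_pos (by norm_num)
  rw [show (1 / 4 + 1 / 2 : ℝ) = 3 / 4 by norm_num, Real.Gamma_one_half_eq] at hbeta
  rw [ellipticIntegral_eq_two_mul, Real.sqrt_mul (by norm_num)]
  have hpi := Real.sq_sqrt Real.pi_pos.le
  have hsp : 0 < √π := Real.sqrt_pos.2 Real.pi_pos
  have hI : ∫ t in Set.Ioi (0 : ℝ), (√((t ^ 2 + 1 ^ 2) * (t ^ 2 + √2 ^ 2)))⁻¹ =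
      Real.Gamma (1 / 4) * √π / Real.Gamma (3 / 4) / 4 := by linarith
  rw [hI]
  have h2 := Real.sq_sqrt (show (0 : ℝ) ≤ 2 by norm_num)
  field_simp
  rw [hpi]
  linear_combination (-4) * hG

lemma hasDerivAt_ofReal_cpow_neg {x : ℝ} (hx : 0 < x) (w : ℂ) :
    HasDerivAt (fun t : ℝ => (t : ℂ) ^ (-w)) (-w * (x : ℂ) ^ (-w - 1)) x := by
  rcases eq_or_ne w 0 with rfl | hw
  · simpa using hasDerivAt_const x (1 : ℂ)
  · exact hasDerivAt_ofReal_cpow_const hx.ne' (neg_ne_zero.2 hw)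

/-- Mean value bound for a complex power of a positive real variable. -/
lemma norm_cpow_neg_sub_cpow_neg_le {x y : ℝ} (hx : 0 < x) (hxy : x ≤ y) {w : ℂ}
    (hw : -1 ≤ w.re) :
    ‖(y : ℂ) ^ (-w) - (x : ℂ) ^ (-w)‖ ≤ ‖w‖ * x ^ (-w.re - 1) * (y - x) := by
  refine norm_image_sub_le_of_norm_deriv_le_segment' (f := fun t : ℝ => (t : ℂ) ^ (-w))
    (f' := fun t : ℝ => -w * (t : ℂ) ^ (-w - 1))
    (fun t ht => (hasDerivAt_ofReal_cpow_neg (hx.trans_le ht.1) w).hasDerivWithinAt)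
    (fun t ht => ?_) y ⟨hxy, le_rfl⟩
  rw [norm_mul, norm_neg, Complex.norm_cpow_eq_rpow_re_of_pos (hx.trans_le ht.1)]
  simp only [Complex.sub_re, Complex.neg_re, Complex.one_re]
  gcongr ‖w‖ * ?_
  exact Real.rpow_le_rpow_of_nonpos hx ht.1 (by linarith)

/-- Second order mean value bound for a complex power of a positive real variable. -/
lemma norm_cpow_neg_sub_cpow_neg_add_le {x y z : ℝ} (hx : 0 < x) (hxy : x ≤ y) (hyz : y ≤ z)
    {w : ℂ} (hw : -2 ≤ w.re) :
    ‖(y : ℂ) ^ (-w) - (x : ℂ) ^ (-w) + w * (z : ℂ) ^ (-w - 1) * (y - x)‖ ≤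
      ‖w‖ * (‖w + 1‖ * x ^ (-w.re - 2) * (z - x)) * (y - x) := by
  have h := norm_image_sub_le_of_norm_deriv_le_segment' (a := x) (b := y)
    (f := fun t : ℝ => (t : ℂ) ^ (-w) + w * (z : ℂ) ^ (-w - 1) * t)
    (f' := fun t : ℝ => -w * (t : ℂ) ^ (-w - 1) + w * (z : ℂ) ^ (-w - 1) * 1)
    (C := ‖w‖ * (‖w + 1‖ * x ^ (-w.re - 2) * (z - x)))
    (fun t ht => ((hasDerivAt_ofReal_cpow_neg (hx.trans_le ht.1) w).add
      ((hasDerivAt_id t).ofReal_comp.const_mul _)).hasDerivWithinAt)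
    (fun t ht => ?_) y ⟨hxy, le_rfl⟩
  · refine le_of_eq_of_le (congrArg norm ?_) h
    ring
  · have ht0 : 0 < t := hx.trans_le ht.1
    have h1 := norm_cpow_neg_sub_cpow_neg_le ht0 (ht.2.le.trans hyz) (w := w + 1)
      (by simp only [Complex.add_re, Complex.one_re]; linarith)
    rw [show -w * (t : ℂ) ^ (-w - 1) + w * (z : ℂ) ^ (-w - 1) * 1 =
      w * ((z : ℂ) ^ (-(w + 1)) - (t : ℂ) ^ (-(w + 1))) by ring_nf, norm_mul]
    gcongr
    refine h1.trans ?_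
    simp only [Complex.add_re, Complex.one_re]
    rw [show -(w.re + 1) - 1 = -w.re - 2 by ring]
    have h2 : t ^ (-w.re - 2) ≤ x ^ (-w.re - 2) :=
      Real.rpow_le_rpow_of_nonpos hx ht.1 (by linarith)
    have h3 : z - t ≤ z - x := by linarith [ht.1]
    have h4 : 0 ≤ z - t := by linarith [ht.2]
    gcongr

/-- The `n`-th pair of terms in the Dirichlet series of `χ₋₄`. -/
noncomputable def chi4Pair (n : ℕ) (s : ℂ) : ℂ :=
  ((4 * n + 1 : ℝ) : ℂ) ^ (-s) - ((4 * n + 3 : ℝ) : ℂ) ^ (-s)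

lemma hasDerivAt_ofReal_cpow_neg_exponent {x : ℝ} (hx : 0 < x) (s : ℂ) :
    HasDerivAt (fun s : ℂ => (x : ℂ) ^ (-s)) (-(Real.log x * (x : ℂ) ^ (-s))) s := by
  have h := (hasDerivAt_neg s).const_cpow (c := (x : ℂ)) (Or.inl (by exact_mod_cast hx.ne'))
  refine h.congr_deriv ?_
  rw [Complex.ofReal_log hx.le]
  ring

lemma hasDerivAt_chi4Pair (n : ℕ) (s : ℂ) :
    HasDerivAt (chi4Pair n)
      (-(Real.log (4 * n + 1) * ((4 * n + 1 : ℝ) : ℂ) ^ (-s)) +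
        Real.log (4 * n + 3) * ((4 * n + 3 : ℝ) : ℂ) ^ (-s)) s := by
  have h := (hasDerivAt_ofReal_cpow_neg_exponent (x := 4 * n + 1) (by positivity) s).sub
    (hasDerivAt_ofReal_cpow_neg_exponent (x := 4 * n + 3) (by positivity) s)
  exact h.congr_deriv (by ring)

/-- The truncated half plane `Re s > δ`, `|s| < 4`. -/
def halfDisc (δ : ℝ) : Set ℂ := {s : ℂ | δ < s.re} ∩ Metric.ball 0 4

lemma isOpen_halfDisc (δ : ℝ) : IsOpen (halfDisc δ) :=
  (isOpen_lt continuous_const Complex.continuous_re).inter Metric.isOpen_ball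

lemma isPreconnected_halfDisc (δ : ℝ) : IsPreconnected (halfDisc δ) :=
  ((convex_halfSpace_re_gt δ).inter (convex_ball 0 4)).isPreconnected

lemma rpow_four_mul_add_one_le {a b : ℝ} (hab : a ≤ b) (hb : b ≤ 0) (n : ℕ) :
    (4 * n + 1 : ℝ) ^ a ≤ (n + 1 : ℝ) ^ b :=
  (Real.rpow_le_rpow_of_exponent_le (by linarith [n.cast_nonneg (α := ℝ)]) hab).trans
    (Real.rpow_le_rpow_of_nonpos (by positivity) (by linarith [n.cast_nonneg (α := ℝ)]) hb)

lemma summable_const_mul_add_one_rpow (C : ℝ) {b : ℝ} (hb : b < -1) :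
    Summable fun n : ℕ => C * (n + 1 : ℝ) ^ b := by
  have h := (Real.summable_one_div_nat_add_rpow 1 (-b)).2 (by linarith)
  refine (h.congr fun n => ?_).mul_left C
  rw [abs_of_pos (by positivity), Real.rpow_neg (by positivity), one_div, inv_inv]

lemma norm_chi4Pair_le {δ : ℝ} (hδ : 0 < δ) (n : ℕ) {s : ℂ} (hs : s ∈ halfDisc δ) :
    ‖chi4Pair n s‖ ≤ 8 * (n + 1 : ℝ) ^ (-δ - 1) := by
  obtain ⟨h1 : δ < s.re, h2⟩ := hs
  rw [mem_ball_zero_iff] at h2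
  have h := norm_cpow_neg_sub_cpow_neg_le (x := 4 * n + 1) (y := 4 * n + 3) (w := s)
    (by positivity) (by linarith) (by linarith)
  rw [chi4Pair, norm_sub_rev]
  refine h.trans ?_
  have h3 := rpow_four_mul_add_one_le (a := -s.re - 1) (b := -δ - 1) (by linarith) (by linarith) n
  calc ‖s‖ * (4 * n + 1 : ℝ) ^ (-s.re - 1) * (4 * n + 3 - (4 * n + 1))
      = (‖s‖ * 2) * (4 * n + 1 : ℝ) ^ (-s.re - 1) := by ring
    _ ≤ 8 * (n + 1 : ℝ) ^ (-δ - 1) := by gcongr; linarith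

/-- A pair of terms in the Dirichlet series of `χ₋₄`, minus its leading asymptotics. -/
noncomputable def chi4PairRem (n : ℕ) (s : ℂ) : ℂ :=
  chi4Pair n s - 2 * s * ((4 * n + 4 : ℝ) : ℂ) ^ (-s - 1)

lemma norm_chi4PairRem_le (n : ℕ) {s : ℂ} (hs : s ∈ halfDisc (-1 / 2)) :
    ‖chi4PairRem n s‖ ≤ 120 * (n + 1 : ℝ) ^ (-3 / 2 : ℝ) := by
  obtain ⟨h1 : -1 / 2 < s.re, h2⟩ := hs
  rw [mem_ball_zero_iff] at h2
  have h := norm_cpow_neg_sub_cpow_neg_add_le (x := 4 * n + 1) (y := 4 * n + 3) (z := 4 * n + 4)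
    (w := s) (by positivity) (by linarith) (by linarith) (by linarith)
  have heq : chi4PairRem n s = -(((4 * n + 3 : ℝ) : ℂ) ^ (-s) - ((4 * n + 1 : ℝ) : ℂ) ^ (-s) +
      s * ((4 * n + 4 : ℝ) : ℂ) ^ (-s - 1) * (((4 * n + 3 : ℝ) : ℂ) - ((4 * n + 1 : ℝ) : ℂ))) := by
    rw [chi4PairRem, chi4Pair]
    push_cast
    ring
  rw [heq, norm_neg]
  refine h.trans ?_
  have h3 := rpow_four_mul_add_one_le (a := -s.re - 2) (b := -3 / 2) (by linarith) (by linarith) n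
  have h4 : ‖s + 1‖ ≤ 5 := (norm_add_le _ _).trans (by rw [norm_one]; linarith)
  calc ‖s‖ * (‖s + 1‖ * (4 * n + 1 : ℝ) ^ (-s.re - 2) * (4 * n + 4 - (4 * n + 1))) *
        (4 * n + 3 - (4 * n + 1))
      = (‖s‖ * (‖s + 1‖ * 6)) * (4 * n + 1 : ℝ) ^ (-s.re - 2) := by ring
    _ ≤ (4 * (5 * 6)) * (n + 1 : ℝ) ^ (-3 / 2 : ℝ) := by gcongr
    _ = 120 * (n + 1 : ℝ) ^ (-3 / 2 : ℝ) := by norm_num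

lemma differentiable_chi4PairRem (n : ℕ) : Differentiable ℂ (chi4PairRem n) := by
  intro s
  have h := (hasDerivAt_ofReal_cpow_neg_exponent (x := 4 * n + 4) (by positivity) (s + 1))
  have h2 : DifferentiableAt ℂ (fun s : ℂ => ((4 * n + 4 : ℝ) : ℂ) ^ (-s - 1)) s := by
    have h3 := h.differentiableAt.comp s (differentiableAt_id.add_const (1 : ℂ))
    refine h3.congr_of_eventuallyEq (Eventually.of_forall fun z => ?_)
    simp only [Function.comp, id]
    ring_nf
  exact (hasDerivAt_chi4Pair n s).differentiableAt.sub
    ((differentiableAt_id.const_mul 2).mul h2)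

lemma tendsto_sum_range_four_mul {E : Type*} [AddCommMonoid E] [TopologicalSpace E]
    {u : ℕ → E} {l : E} (h : Tendsto (fun N => ∑ n ∈ Finset.range N, u n) atTop (nhds l)) :
    Tendsto (fun N => ∑ k ∈ Finset.range N,
      (u (4 * k) + u (4 * k + 1) + u (4 * k + 2) + u (4 * k + 3))) atTop (nhds l) := by
  refine (h.comp (tendsto_id.const_mul_atTop' (show 0 < 4 by norm_num))).congr fun N => ?_
  simp only [Function.comp, id]
  induction N with
  | zero => simp
  | succ N ih =>
    rw [Finset.sum_range_succ, ← ih, show 4 * (N + 1) = 4 * N + 3 + 1 by ring,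
      Finset.sum_range_succ, Finset.sum_range_succ, Finset.sum_range_succ, Finset.sum_range_succ]
    simp only [add_assoc]

/-- The Dirichlet `L`-function of `χ₋₄`. -/
noncomputable def chi4L (s : ℂ) : ℂ := HurwitzZeta.sinZeta ((1 / 4 : ℝ) : UnitAddCircle) s

lemma differentiable_chi4L : Differentiable ℂ chi4L :=
  HurwitzZeta.differentiableAt_sinZeta _

lemma hasSum_chi4Pair_of_one_lt {s : ℂ} (hs : 1 < s.re) (h4 : ‖s‖ < 4) :
    HasSum (fun n => chi4Pair n s) (chi4L s) := by
  have hsum : Summable fun n => chi4Pair n s :=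
    .of_norm_bounded (summable_const_mul_add_one_rpow 8 (by norm_num))
      fun n => norm_chi4Pair_le one_pos n ⟨hs, mem_ball_zero_iff.2 h4⟩
  have h := tendsto_sum_range_four_mul (HurwitzZeta.hasSum_nat_sinZeta (1 / 4) hs).tendsto_sum_nat
  have hlim : Tendsto (fun N => ∑ n ∈ Finset.range N, chi4Pair n s) atTop (nhds (chi4L s)) := by
    refine h.congr fun N => Finset.sum_congr rfl fun k _ => ?_
    have e0 : Real.sin (2 * π * (1 / 4) * (4 * k : ℕ)) = 0 := by
      rw [show 2 * π * (1 / 4) * (4 * k : ℕ) = 0 + k * (2 * π) by push_cast; ring,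
        Real.sin_add_nat_mul_two_pi, Real.sin_zero]
    have e1 : Real.sin (2 * π * (1 / 4) * (4 * k + 1 : ℕ)) = 1 := by
      rw [show 2 * π * (1 / 4) * (4 * k + 1 : ℕ) = π / 2 + k * (2 * π) by push_cast; ring,
        Real.sin_add_nat_mul_two_pi, Real.sin_pi_div_two]
    have e2 : Real.sin (2 * π * (1 / 4) * (4 * k + 2 : ℕ)) = 0 := by
      rw [show 2 * π * (1 / 4) * (4 * k + 2 : ℕ) = π + k * (2 * π) by push_cast; ring,
        Real.sin_add_nat_mul_two_pi, Real.sin_pi]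
    have e3 : Real.sin (2 * π * (1 / 4) * (4 * k + 3 : ℕ)) = -1 := by
      rw [show 2 * π * (1 / 4) * (4 * k + 3 : ℕ) = π / 2 + π + k * (2 * π) by push_cast; ring,
        Real.sin_add_nat_mul_two_pi, Real.sin_add_pi, Real.sin_pi_div_two]
    rw [e0, e1, e2, e3, chi4Pair, Complex.cpow_neg, Complex.cpow_neg]
    push_cast
    ring
  exact tendsto_nhds_unique hsum.hasSum.tendsto_sum_nat hlim ▸ hsum.hasSum

lemma eqOn_tsum_chi4Pair {δ : ℝ} (hδ : 0 < δ) (hδ1 : δ < 2) :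
    Set.EqOn (fun s => ∑' n, chi4Pair n s) chi4L (halfDisc δ) := by
  have hd : DifferentiableOn ℂ (fun s => ∑' n, chi4Pair n s) (halfDisc δ) :=
    Complex.differentiableOn_tsum_of_summable_norm
      (summable_const_mul_add_one_rpow 8 (by linarith))
      (fun n s _ => (hasDerivAt_chi4Pair n s).differentiableAt.differentiableWithinAt)
      (isOpen_halfDisc δ) fun n s hs => norm_chi4Pair_le hδ n hs
  refine (hd.analyticOnNhd (isOpen_halfDisc δ)).eqOn_of_preconnected_of_eventuallyEq
    (fun s _ => differentiable_chi4L.analyticAt s) (isPreconnected_halfDisc δ) (z₀ := 2)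
    ⟨by simpa using hδ1, by norm_num [mem_ball_zero_iff]⟩ ?_
  filter_upwards [(isOpen_halfDisc 1).mem_nhds (x := 2)
    ⟨by simp, by norm_num [mem_ball_zero_iff]⟩] with s hs
  exact (hasSum_chi4Pair_of_one_lt hs.1 (mem_ball_zero_iff.1 hs.2)).tsum_eq

lemma hasSum_chi4Pair {δ : ℝ} (hδ : 0 < δ) (hδ1 : δ < 2) {s : ℂ} (hs : s ∈ halfDisc δ) :
    HasSum (fun n => chi4Pair n s) (chi4L s) := by
  have hsum : Summable fun n => chi4Pair n s :=
    .of_norm_bounded (summable_const_mul_add_one_rpow 8 (by linarith))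
      fun n => norm_chi4Pair_le hδ n hs
  exact eqOn_tsum_chi4Pair hδ hδ1 hs ▸ hsum.hasSum

lemma one_mem_halfDisc : (1 : ℂ) ∈ halfDisc (1 / 2) :=
  ⟨by norm_num, by simp⟩

lemma hasSum_deriv_chi4Pair_one :
    HasSum (fun n => deriv (chi4Pair n) 1) (deriv chi4L 1) := by
  have h := Complex.hasSum_deriv_of_summable_norm
    (summable_const_mul_add_one_rpow 8 (b := -(1 / 2) - 1) (by norm_num))
    (fun n s _ => (hasDerivAt_chi4Pair n s).differentiableAt.differentiableWithinAt)
    (isOpen_halfDisc (1 / 2)) (fun n s hs => norm_chi4Pair_le (by norm_num) n hs)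
    one_mem_halfDisc
  rwa [((eqOn_tsum_chi4Pair (by norm_num) (by norm_num)).eventuallyEq_of_mem
    ((isOpen_halfDisc (1 / 2)).mem_nhds one_mem_halfDisc)).deriv_eq] at h

lemma hurwitzZetaOdd_one_quarter (s : ℂ) :
    HurwitzZeta.hurwitzZetaOdd ((1 / 4 : ℝ) : UnitAddCircle) s = 4 ^ s * chi4L s / 2 := by
  have hd : Differentiable ℂ fun s : ℂ => (4 : ℂ) ^ s * chi4L s / 2 :=
    ((differentiable_id.const_cpow (Or.inl (by norm_num))).mul differentiable_chi4L).div_const 2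
  refine congrFun (AnalyticOnNhd.eq_of_eventuallyEq (z₀ := 2)
    (fun s _ => (HurwitzZeta.differentiable_hurwitzZetaOdd _).analyticAt s)
    (fun s _ => hd.analyticAt s) ?_) s
  filter_upwards [(isOpen_halfDisc 1).mem_nhds (x := 2)
    ⟨by simp, by norm_num [mem_ball_zero_iff]⟩] with s hs
  have h := HurwitzZeta.hasSum_nat_hurwitzZetaOdd_of_mem_Icc (a := 1 / 4) (by norm_num) hs.1
  have h2 := ((hasSum_chi4Pair_of_one_lt hs.1 (mem_ball_zero_iff.1 hs.2)).mul_left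
    ((4 : ℂ) ^ s)).div_const 2
  refine h.unique (h2.congr_fun fun n => ?_)
  have hscale : ∀ x : ℝ, 0 ≤ x → (4 : ℂ) ^ s * ((4 * x : ℝ) : ℂ) ^ (-s) = 1 / (x : ℂ) ^ s := by
    intro x hx
    rw [Complex.ofReal_mul, Complex.mul_cpow_ofReal_nonneg (by norm_num) hx, ← mul_assoc,
      Complex.ofReal_ofNat, ← Complex.cpow_add _ _ (by norm_num), add_neg_cancel,
      Complex.cpow_zero, one_mul, Complex.cpow_neg, one_div]
  have e1 := hscale (n + 1 / 4) (by positivity)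
  have e2 := hscale (n + 1 - 1 / 4) (by linarith [n.cast_nonneg (α := ℝ)])
  rw [chi4Pair, mul_sub, show (4 * n + 1 : ℝ) = 4 * (n + 1 / 4) by ring,
    show (4 * n + 3 : ℝ) = 4 * (n + 1 - 1 / 4) by ring, e1, e2]
  push_cast
  rfl

lemma zero_mem_halfDisc : (0 : ℂ) ∈ halfDisc (-1 / 2) :=
  ⟨by norm_num, by simp⟩

lemma hasDerivAt_chi4PairRem_zero (n : ℕ) :
    HasDerivAt (chi4PairRem n)
      ((Real.log (3 / 4 + n) - Real.log (1 / 4 + n) - 1 / 2 * (n + 1 : ℝ)⁻¹ : ℝ) : ℂ) 0 := by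
  have h1 : HasDerivAt (fun s : ℂ => 2 * s * ((4 * n + 4 : ℝ) : ℂ) ^ (-s - 1))
      (2 * ((4 * n + 4 : ℝ) : ℂ)⁻¹) 0 := by
    have hne : ((4 * n + 4 : ℝ) : ℂ) ≠ 0 := by
      exact_mod_cast (show (4 * n + 4 : ℝ) ≠ 0 by positivity)
    have h := ((hasDerivAt_id (0 : ℂ)).const_mul 2).mul
      (((hasDerivAt_neg (0 : ℂ)).sub_const 1).const_cpow (c := ((4 * n + 4 : ℝ) : ℂ)) (Or.inl hne))
    refine h.congr_deriv ?_
    simp [Complex.cpow_neg_one]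
  refine ((hasDerivAt_chi4Pair n 0).sub h1).congr_deriv ?_
  have e3 : Real.log (4 * n + 3) = Real.log 4 + Real.log (3 / 4 + n) := by
    rw [← Real.log_mul (by norm_num) (by positivity)]
    ring_nf
  have e1 : Real.log (4 * n + 1) = Real.log 4 + Real.log (1 / 4 + n) := by
    rw [← Real.log_mul (by norm_num) (by positivity)]
    ring_nf
  have e4 : 2 * (4 * n + 4 : ℝ)⁻¹ = 1 / 2 * (n + 1 : ℝ)⁻¹ := by
    field_simp
    ring
  rw [neg_zero, Complex.cpow_zero, Complex.cpow_zero, mul_one, mul_one, e1, e3, ← e4]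
  push_cast
  ring

lemma tendsto_sum_log_sub_log_sub_inv :
    Tendsto (fun N : ℕ => ∑ n ∈ Finset.range N,
      (Real.log (3 / 4 + n) - Real.log (1 / 4 + n) - 1 / 2 * (n + 1 : ℝ)⁻¹)) atTop
      (nhds (Real.log (Real.Gamma (1 / 4)) - Real.log (Real.Gamma (3 / 4)) -
        Real.eulerMascheroniConstant / 2)) := by
  rw [← tendsto_add_atTop_iff_nat 1]
  have h1 := Real.BohrMollerup.tendsto_log_gamma (x := 1 / 4) (by norm_num)
  have h3 := Real.BohrMollerup.tendsto_log_gamma (x := 3 / 4) (by norm_num)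
  have hH := (Real.tendsto_harmonic_sub_log.add
    (tendsto_one_div_add_atTop_nhds_zero_nat (𝕜 := ℝ))).div_const 2
  rw [add_zero] at hH
  refine ((h1.sub h3).sub hH).congr fun n => ?_
  have hharm : ∑ m ∈ Finset.range (n + 1), (m + 1 : ℝ)⁻¹ = (harmonic n : ℝ) + 1 / (n + 1) := by
    rw [Finset.sum_range_succ, harmonic]
    push_cast
    rw [one_div]
  rw [Real.BohrMollerup.logGammaSeq, Real.BohrMollerup.logGammaSeq, Finset.sum_sub_distrib,
    Finset.sum_sub_distrib, ← Finset.mul_sum, hharm]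
  ring

lemma hasDerivAt_tsum_chi4PairRem_zero :
    HasDerivAt (fun s => ∑' n, chi4PairRem n s)
      ((Real.log (Real.Gamma (1 / 4)) - Real.log (Real.Gamma (3 / 4)) -
        Real.eulerMascheroniConstant / 2 : ℝ) : ℂ) 0 := by
  have hu := summable_const_mul_add_one_rpow 120 (b := -3 / 2) (by norm_num)
  have hf := fun n => (differentiable_chi4PairRem n).differentiableOn (s := halfDisc (-1 / 2))
  have hle := fun n s => norm_chi4PairRem_le n (s := s)
  have hd := (Complex.differentiableOn_tsum_of_summable_norm hu hf (isOpen_halfDisc _)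
    hle).differentiableAt ((isOpen_halfDisc _).mem_nhds zero_mem_halfDisc)
  have hs := Complex.hasSum_deriv_of_summable_norm hu hf (isOpen_halfDisc _) hle zero_mem_halfDisc
  refine hd.hasDerivAt.congr_deriv ?_
  have hlim := hs.tendsto_sum_nat
  simp_rw [fun n => (hasDerivAt_chi4PairRem_zero n).deriv, ← Complex.ofReal_sum] at hlim
  exact tendsto_nhds_unique hlim
    ((Complex.continuous_ofReal.tendsto _).comp tendsto_sum_log_sub_log_sub_inv)

lemma chi4L_eq_tsum_chi4PairRem_add {s : ℂ} (h0 : 0 < s.re) (h2 : s.re < 2) (h4 : ‖s‖ < 4) :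
    chi4L s = ∑' n, chi4PairRem n s + 4 ^ (-s) / 2 * (s * riemannZeta (s + 1)) := by
  have h := hasSum_chi4Pair (δ := s.re / 2) (by linarith) (by linarith)
    ⟨show s.re / 2 < s.re by linarith, mem_ball_zero_iff.2 h4⟩
  have hr : Summable fun n => chi4PairRem n s :=
    .of_norm_bounded (summable_const_mul_add_one_rpow 120 (b := -3 / 2) (by norm_num))
      fun n => norm_chi4PairRem_le n ⟨show -1 / 2 < s.re by linarith, mem_ball_zero_iff.2 h4⟩
  have hdiff := (h.sub hr.hasSum).tsum_eq
  rw [zeta_eq_tsum_one_div_nat_add_one_cpow (by simpa using h0), ← tsum_mul_left, ← tsum_mul_left,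
    ← sub_eq_iff_eq_add', ← hdiff]
  refine tsum_congr fun n => ?_
  rw [chi4PairRem, sub_sub_cancel, show (4 * n + 4 : ℝ) = 4 * (n + 1) by ring,
    Complex.ofReal_mul, Complex.mul_cpow_ofReal_nonneg (by norm_num) (by positivity),
    Complex.ofReal_ofNat, Complex.cpow_sub _ _ (by norm_num), Complex.cpow_one,
    show -s - 1 = -(s + 1) by ring, Complex.cpow_neg _ (s + 1)]
  push_cast
  ring

lemma tendsto_riemannZeta_add_one_sub_inv :
    Tendsto (fun s : ℂ => riemannZeta (s + 1) - s⁻¹) (nhdsWithin 0 {0}ᶜ)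
      (nhds (Real.eulerMascheroniConstant : ℂ)) := by
  have h : Tendsto (fun s : ℂ => s + 1) (nhdsWithin 0 {0}ᶜ) (nhdsWithin 1 {1}ᶜ) := by
    refine tendsto_nhdsWithin_iff.2 ⟨?_, ?_⟩
    · have : Tendsto (fun s : ℂ => s + 1) (nhds 0) (nhds (0 + 1)) :=
        (continuous_add_const 1).tendsto 0
      rw [zero_add] at this
      exact this.mono_left nhdsWithin_le_nhds
    · filter_upwards [self_mem_nhdsWithin] with s hs
      simpa using hs
  refine (tendsto_riemannZeta_sub_one_div.comp h).congr fun s => ?_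
  simp

lemma chi4L_zero_and_deriv_chi4L_zero :
    chi4L 0 = 1 / 2 ∧ deriv chi4L 0 =
      ((Real.log (Real.Gamma (1 / 4)) - Real.log (Real.Gamma (3 / 4)) - Real.log 4 / 2 : ℝ) : ℂ) := by
  set l : Filter ℂ := map (fun x : ℝ => (x : ℂ)) (nhdsWithin 0 (Set.Ioi 0)) with hl
  have hl0 : l ≤ nhdsWithin 0 {0}ᶜ := by
    refine tendsto_nhdsWithin_iff.2 ⟨?_, ?_⟩
    · exact (Complex.continuous_ofReal.tendsto 0).mono_left nhdsWithin_le_nhds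
    · filter_upwards [self_mem_nhdsWithin] with x (hx : 0 < x)
      simpa using hx.ne'
  have hl1 : l ≤ nhds 0 := hl0.trans nhdsWithin_le_nhds
  set T : ℂ → ℂ := fun s => ∑' n, chi4PairRem n s with hT
  set Z : ℂ → ℂ := fun s => riemannZeta (s + 1) - s⁻¹ with hZ
  have hev : ∀ᶠ s in l, s ≠ 0 ∧ chi4L s = T s + 4 ^ (-s) / 2 * (1 + s * Z s) := by
    rw [hl, eventually_map]
    filter_upwards [Ioo_mem_nhdsGT (show (0 : ℝ) < 1 by norm_num)] with x hx
    have hx0 : (x : ℂ) ≠ 0 := by exact_mod_cast hx.1.ne'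
    refine ⟨hx0, ?_⟩
    rw [chi4L_eq_tsum_chi4PairRem_add (by simpa using hx.1) (by simpa using by linarith [hx.2])
      (by rw [Complex.norm_of_nonneg hx.1.le]; linarith [hx.2]), hZ]
    field_simp
    ring
  have hT0 : T 0 = 0 := by simp [hT, chi4PairRem, chi4Pair]
  have hTd := hasDerivAt_tsum_chi4PairRem_zero
  have hZl : Tendsto Z l (nhds (Real.eulerMascheroniConstant : ℂ)) :=
    tendsto_riemannZeta_add_one_sub_inv.mono_left hl0
  have hpow : HasDerivAt (fun s : ℂ => (4 : ℂ) ^ (-s)) (-(Real.log 4)) 0 := by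
    have h := hasDerivAt_ofReal_cpow_neg_exponent (x := 4) (by norm_num) 0
    simpa using h
  have hpowl : Tendsto (fun s : ℂ => (4 : ℂ) ^ (-s)) l (nhds 1) := by
    have h := hpow.continuousAt.tendsto.mono_left hl1
    simpa using h
  have hidl : Tendsto (fun s : ℂ => s) l (nhds 0) := hl1
  have hzero : chi4L 0 = 1 / 2 := by
    have h1 : Tendsto chi4L l (nhds (chi4L 0)) :=
      (differentiable_chi4L.continuous.tendsto 0).mono_left hl1
    have h2 : Tendsto (fun s => T s + 4 ^ (-s) / 2 * (1 + s * Z s)) l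
        (nhds (T 0 + 1 / 2 * (1 + 0 * (Real.eulerMascheroniConstant : ℂ)))) :=
      (hTd.continuousAt.tendsto.mono_left hl1).add
        ((hpowl.div_const 2).mul (tendsto_const_nhds.add (hidl.mul hZl)))
    have h3 := tendsto_nhds_unique (h1.congr' (hev.mono fun s hs => hs.2)) h2
    rw [h3, hT0]
    ring
  refine ⟨hzero, ?_⟩
  have h1 := (hasDerivAt_iff_tendsto_slope.1
    (differentiable_chi4L 0).hasDerivAt).mono_left hl0
  have h2 : Tendsto (fun s => slope T 0 s + 4 ^ (-s) / 2 * Z s +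
      slope (fun s : ℂ => (4 : ℂ) ^ (-s)) 0 s / 2) l (nhds _) :=
    ((((hasDerivAt_iff_tendsto_slope.1 hTd).mono_left hl0).add
      ((hpowl.div_const 2).mul hZl)).add
      (((hasDerivAt_iff_tendsto_slope.1 hpow).mono_left hl0).div_const 2))
  refine (tendsto_nhds_unique (h1.congr' (hev.mono fun s hs => ?_)) h2).trans ?_
  · simp only [slope, vsub_eq_sub, smul_eq_mul, sub_zero, hT0, hzero, hs.2, neg_zero,
      Complex.cpow_zero]
    have hs0 := hs.1
    field_simp
    ring
  · push_cast
    ring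

lemma chi4L_one_sub {s : ℂ} (hs : 0 < s.re) :
    4 ^ (1 - s) * chi4L (1 - s) / 2 =
      2 * (2 * π) ^ (-s) * Complex.Gamma s * Complex.sin (π * s / 2) * chi4L s := by
  rw [← hurwitzZetaOdd_one_quarter, chi4L]
  refine HurwitzZeta.hurwitzZetaOdd_one_sub _ fun n hn => ?_
  have : s.re = -n := by simp [hn]
  linarith [n.cast_nonneg (α := ℝ)]

lemma chi4L_one : chi4L 1 = π / 4 := by
  have h := chi4L_one_sub (s := 1) (by simp)
  rw [sub_self, Complex.cpow_zero, chi4L_zero_and_deriv_chi4L_zero.1, Complex.Gamma_one, mul_one,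
    mul_one, Complex.sin_pi_div_two, Complex.cpow_neg_one] at h
  have hpi : (π : ℂ) ≠ 0 := by exact_mod_cast Real.pi_ne_zero
  field_simp at h
  rw [eq_div_iff (by norm_num)]
  linear_combination -h

lemma deriv_chi4L_one : deriv chi4L 1 = π / 4 *
    ((Real.log (2 * π) + Real.eulerMascheroniConstant - 2 * Real.log (Real.Gamma (1 / 4)) +
      2 * Real.log (Real.Gamma (3 / 4)) : ℝ) : ℂ) := by
  have hpi : (π : ℂ) ≠ 0 := by exact_mod_cast Real.pi_ne_zero
  have hL1 := (differentiable_chi4L 1).hasDerivAt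
  have hL0 : HasDerivAt chi4L (deriv chi4L 0) (1 - 1) := by
    rw [sub_self]
    exact (differentiable_chi4L 0).hasDerivAt
  have hsub := (hasDerivAt_id (1 : ℂ)).const_sub 1
  have hleft : HasDerivAt (fun s : ℂ => 4 ^ (1 - s) * chi4L (1 - s) / 2) _ 1 :=
    ((hsub.const_cpow (c := 4) (Or.inl (by norm_num))).mul (hL0.comp 1 hsub)).div_const 2
  have hpow : HasDerivAt (fun s : ℂ => (2 * π : ℂ) ^ (-s))
      (-(Real.log (2 * π) * (2 * π : ℂ) ^ (-1 : ℂ))) 1 := by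
    simpa using hasDerivAt_ofReal_cpow_neg_exponent Real.two_pi_pos 1
  have hsin : HasDerivAt (fun s : ℂ => Complex.sin (π * s / 2))
      (Complex.cos (π * 1 / 2) * (π * 1 / 2)) 1 :=
    (((hasDerivAt_id (1 : ℂ)).const_mul (π : ℂ)).div_const 2).csin
  have hright : HasDerivAt (fun s : ℂ =>
      2 * (2 * π) ^ (-s) * Complex.Gamma s * Complex.sin (π * s / 2) * chi4L s) _ 1 :=
    (((hpow.const_mul 2).mul Complex.hasDerivAt_Gamma_one).mul hsin).mul hL1
  have heq : (fun s : ℂ => 4 ^ (1 - s) * chi4L (1 - s) / 2) =ᶠ[nhds 1] fun s : ℂ =>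
      2 * (2 * π) ^ (-s) * Complex.Gamma s * Complex.sin (π * s / 2) * chi4L s := by
    filter_upwards [(isOpen_lt continuous_const Complex.continuous_re).mem_nhds
      (show (0 : ℝ) < (1 : ℂ).re by simp)] with s hs
    exact chi4L_one_sub hs
  have h := hleft.unique (hright.congr_of_eventuallyEq heq)
  have hlog4 : Complex.log 4 = ((Real.log 4 : ℝ) : ℂ) := by
    rw [Complex.ofReal_log (by norm_num)]
    norm_num
  simp only [id, Function.comp_apply, Pi.mul_apply, sub_self, Complex.cpow_zero,
    chi4L_zero_and_deriv_chi4L_zero.1, chi4L_zero_and_deriv_chi4L_zero.2, chi4L_one, hlog4, mul_one, Complex.sin_pi_div_two,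
    Complex.cos_pi_div_two, Complex.Gamma_one, Complex.cpow_neg_one, zero_mul, mul_zero] at h
  push_cast at h ⊢
  field_simp at h ⊢
  linear_combination (-1 / 4) * h

lemma chi4_four_mul_add (k : ℕ) :
    chi4 (4 * k) = 0 ∧ chi4 (4 * k + 1) = 1 ∧ chi4 (4 * k + 2) = 0 ∧ chi4 (4 * k + 3) = -1 := by
  simp [chi4, Nat.add_mod]

lemma eq_chi4L_one {L : ℝ}
    (hL : Tendsto (fun N : ℕ => ∑ n ∈ Finset.range N, chi4 n / (n : ℝ)) atTop (nhds L)) :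
    (L : ℂ) = chi4L 1 := by
  have h1 := (Complex.continuous_ofReal.tendsto _).comp (tendsto_sum_range_four_mul hL)
  refine tendsto_nhds_unique h1 ((hasSum_chi4Pair (by norm_num) (by norm_num)
    one_mem_halfDisc).tendsto_sum_nat.congr fun N => ?_)
  simp only [Function.comp_apply, Complex.ofReal_sum]
  refine Finset.sum_congr rfl fun k _ => ?_
  obtain ⟨e0, e1, e2, e3⟩ := chi4_four_mul_add k
  rw [e0, e1, e2, e3, chi4Pair, Complex.cpow_neg_one, Complex.cpow_neg_one]
  push_cast
  ring

lemma eq_deriv_chi4L_one {L' : ℝ}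
    (hL' : Tendsto (fun N : ℕ => -∑ n ∈ Finset.range N, chi4 n * Real.log n / (n : ℝ))
      atTop (nhds L')) :
    (L' : ℂ) = deriv chi4L 1 := by
  simp only [← Finset.sum_neg_distrib] at hL'
  have h1 := (Complex.continuous_ofReal.tendsto _).comp (tendsto_sum_range_four_mul hL')
  refine tendsto_nhds_unique h1 (hasSum_deriv_chi4Pair_one.tendsto_sum_nat.congr fun N => ?_)
  simp only [Function.comp_apply, Complex.ofReal_sum]
  refine Finset.sum_congr rfl fun k _ => ?_
  obtain ⟨e0, e1, e2, e3⟩ := chi4_four_mul_add k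
  rw [e0, e1, e2, e3, (hasDerivAt_chi4Pair k 1).deriv, Complex.cpow_neg_one, Complex.cpow_neg_one]
  push_cast
  ring

lemma agm_succ_eq_agmSequences (n : ℕ) :
    (agm (n + 1)).1 = (NNReal.agmSequences 1 (NNReal.sqrt 2) n).2 ∧
      (agm (n + 1)).2 = (NNReal.agmSequences 1 (NNReal.sqrt 2) n).1 := by
  induction n with
  | zero => simp [agm, NNReal.agmSequences_zero]
  | succ n ih =>
    rw [agm, ih.1, ih.2, NNReal.agmSequences_succ']
    simp [add_comm, mul_comm]

lemma agm_one_sqrt_two :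
    (NNReal.agm 1 (NNReal.sqrt 2) : ℝ) = π * (2 * √(2 * π)) / Real.Gamma (1 / 4) ^ 2 := by
  have hpos : 0 < NNReal.agm 1 (NNReal.sqrt 2) := NNReal.agm_pos one_pos (NNReal.sqrt_pos.2 two_pos)
  have hpos' : (NNReal.agm 1 (NNReal.sqrt 2) : ℝ) ≠ 0 := by exact_mod_cast hpos.ne'
  have h := ellipticIntegral_eq_pi_div_agm one_pos (NNReal.sqrt_pos.2 (two_pos (α := NNReal)))
  rw [NNReal.coe_one, Real.coe_sqrt, NNReal.coe_ofNat, ellipticIntegral_one_sqrt_two] at h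
  have hG : 0 < Real.Gamma (1 / 4) := Real.Gamma_pos_of_pos (by norm_num)
  have hs : 0 < √(2 * π) := Real.sqrt_pos.2 Real.two_pi_pos
  field_simp at h ⊢
  linarith

/-- The sequences of Lagrange's AGM algorithm with starting values `1` and `√2`
converge to a common limit `M(1,√2)`, and
`(L'/L)(1,χ₋₄) = log (M(1,√2)² e^γ / 2)`, where `L = L(1,χ₋₄)` and `L' = L'(1,χ₋₄)`
are the limits of the partial sums of `∑ χ₋₄(n)/n` and `-∑ χ₋₄(n) log n / n`. -/
theorem logDeriv_L_one_chi4 (L L' : ℝ)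
    (hL : Tendsto (fun N : ℕ => ∑ n ∈ Finset.range N, chi4 n / (n : ℝ)) atTop (nhds L))
    (hL' : Tendsto (fun N : ℕ => -∑ n ∈ Finset.range N, chi4 n * Real.log n / (n : ℝ))
      atTop (nhds L')) :
    ∃ M : ℝ, Tendsto (fun n => (agm n).1) atTop (nhds M) ∧
      Tendsto (fun n => (agm n).2) atTop (nhds M) ∧
      L' / L = Real.log (M ^ 2 * Real.exp Real.eulerMascheroniConstant / 2) := by
  have hpi := Real.pi_pos
  have hG : 0 < Real.Gamma (1 / 4) := Real.Gamma_pos_of_pos (by norm_num)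
  have hG3 : 0 < Real.Gamma (3 / 4) := Real.Gamma_pos_of_pos (by norm_num)
  refine ⟨NNReal.agm 1 (NNReal.sqrt 2), ?_, ?_, ?_⟩
  · rw [← tendsto_add_atTop_iff_nat 1]
    simp only [(agm_succ_eq_agmSequences _).1]
    exact NNReal.tendsto_coe.2 NNReal.tendsto_agmSequences_snd_agm
  · rw [← tendsto_add_atTop_iff_nat 1]
    simp only [(agm_succ_eq_agmSequences _).2]
    exact NNReal.tendsto_coe.2 NNReal.tendsto_agmSequences_fst_agm
  · have hLval : L = π / 4 := by
      have h := eq_chi4L_one hL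
      rw [chi4L_one] at h
      exact_mod_cast h
    have hL'val : L' = π / 4 * (Real.log (2 * π) + Real.eulerMascheroniConstant -
        2 * Real.log (Real.Gamma (1 / 4)) + 2 * Real.log (Real.Gamma (3 / 4))) := by
      have h := eq_deriv_chi4L_one hL'
      rw [deriv_chi4L_one] at h
      exact_mod_cast h
    rw [hLval, hL'val, mul_div_cancel_left₀ _ (by positivity), agm_one_sqrt_two]
    have hG3val : Real.Gamma (3 / 4) = π * √2 / Real.Gamma (1 / 4) := by
      rw [eq_div_iff hG.ne', mul_comm]
      exact Gamma_one_quarter_mul_Gamma_three_quarters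
    have hM : (π * (2 * √(2 * π)) / Real.Gamma (1 / 4) ^ 2) ^ 2 *
        Real.exp Real.eulerMascheroniConstant / 2 =
        2 * π * Real.Gamma (3 / 4) ^ 2 / Real.Gamma (1 / 4) ^ 2 *
          Real.exp Real.eulerMascheroniConstant := by
      rw [hG3val, div_pow, mul_pow, mul_pow, div_pow, mul_pow,
        Real.sq_sqrt (by positivity : 0 ≤ 2 * π), Real.sq_sqrt (by norm_num : (0 : ℝ) ≤ 2)]
      field_simp
    rw [hM, Real.log_mul (by positivity) (Real.exp_ne_zero _), Real.log_exp,
      Real.log_div (by positivity) (by positivity),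
      Real.log_mul (y := Real.Gamma (3 / 4) ^ 2) (by positivity) (by positivity),
      Real.log_pow, Real.log_pow]
    push_cast
    ring
end

section
/- Let D ≤ −3 be a fundamental discriminant and let γ_{S_D} = lim_{s→1⁺}(L_{S_D}'(s)/L_{S_D}(s) + (1/2)/(s−1)) be the Euler–Kronecker constant of S_D. Then γ_{S_D} exists and 2·γ_{S_D} = γ + (L'/L)(1, χ_D) − Σ_{p : (D/p) = −1} 2·(log p)/(p² − 1) + Σ_{p | D} (log p)/(p − 1), where the sums run over primes and γ is the Euler–Mascheroni constant. -/
open Filter Real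
open scoped Classical

/-- The Kronecker symbol `(D/p)` at a prime `p`: it is `0` if `p ∣ D`, equals the
Jacobi symbol `(D|p)` for odd `p ∤ D`, and for `p = 2 ∤ D` equals `1` if
`D ≡ 1 (mod 8)` and `-1` if `D ≡ 5 (mod 8)`. -/
def kron (D : ℤ) (p : ℕ) : ℤ :=
  if (p : ℤ) ∣ D then 0
  else if p = 2 then (if D % 8 = 1 then 1 else -1)
  else jacobiSym D p

/-- `D` is a fundamental discriminant: either `D ≡ 1 (mod 4)` and `D` is squarefree,
or `D = 4m` with `m` squarefree and `m ≡ 2` or `3 (mod 4)`. -/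
def IsFundamentalDiscriminant (D : ℤ) : Prop :=
  (D % 4 = 1 ∧ Squarefree D) ∨
  (∃ m : ℤ, D = 4 * m ∧ Squarefree m ∧ (m % 4 = 2 ∨ m % 4 = 3))

/-- `S_D`: the multiplicative semigroup generated by the primes `p` with
`(D/p) = 1` together with the squares of the primes `q` with `(D/q) = -1`;
equivalently, the positive integers `n` such that every prime `p ∣ n` has
`(D/p) = 1`, or `(D/p) = -1` and `p` occurs in `n` to an even exponent. -/
def SD (D : ℤ) : Set ℕ :=
  {n : ℕ | 0 < n ∧ ∀ p : ℕ, p.Prime → p ∣ n →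
    (kron D p = 1 ∨ (kron D p = -1 ∧ Even (n.factorization p)))}

/-- `χ` is the completely multiplicative function `χ_D` with `χ_D(p) = (D/p)` on
primes. -/
def IsChiD (D : ℤ) (χ : ℕ → ℤ) : Prop :=
  χ 0 = 0 ∧ χ 1 = 1 ∧ (∀ m n : ℕ, χ (m * n) = χ m * χ n) ∧
    ∀ p : ℕ, p.Prime → χ p = kron D p

/-- `L(s,χ) = ∑_{n ≥ 1} χ(n) n^{-s}` (for real `s > 1`). -/
noncomputable def LChi (χ : ℕ → ℤ) (s : ℝ) : ℝ :=
  ∑' n : ℕ, (χ n : ℝ) * (n : ℝ) ^ (-s)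

/-- `L'(s,χ) = -∑_{n ≥ 1} χ(n) (log n) n^{-s}` (for real `s > 1`). -/
noncomputable def LChi' (χ : ℕ → ℤ) (s : ℝ) : ℝ :=
  -∑' n : ℕ, (χ n : ℝ) * Real.log n * (n : ℝ) ^ (-s)

/-- The Riemann zeta function `ζ(s) = ∑_{n ≥ 1} n^{-s}` (for real `s > 1`). -/
noncomputable def zetaR (s : ℝ) : ℝ := ∑' n : ℕ, (n : ℝ) ^ (-s)

/-- `ζ'(s) = -∑_{n ≥ 1} (log n) n^{-s}` (for real `s > 1`). -/
noncomputable def zetaR' (s : ℝ) : ℝ := -∑' n : ℕ, Real.log n * (n : ℝ) ^ (-s)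

/-- The Dirichlet series `L_S(s) = ∑_{n ∈ S} n^{-s}` of a set `S` of positive
integers (as a function of a real variable `s`). -/
noncomputable def LSeries' (S : Set ℕ) (s : ℝ) : ℝ :=
  ∑' n : ℕ, if n ∈ S then (n : ℝ) ^ (-s) else 0

/-- `γS` is the Euler–Kronecker constant of `S` (with density `δ`), i.e.
`L_S'(s)/L_S(s) + δ/(s-1) → γS` as `s → 1⁺`. -/
def IsEulerKronecker (S : Set ℕ) (δ γS : ℝ) : Prop :=
  Tendsto (fun s : ℝ => deriv (LSeries' S) s / LSeries' S s + δ / (s - 1))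
    (nhdsWithin 1 (Set.Ioi 1)) (nhds γS)

section CompletelyMultiplicative

open LSeries ArithmeticFunction Complex
open scoped ArithmeticFunction.Moebius

/-- Pointwise multiplication by a completely multiplicative function distributes over
Dirichlet convolution. -/
lemma mul_convolution_mul (f : ℕ →*₀ ℂ) (g h : ℕ → ℂ) :
    convolution (⇑f * g) (⇑f * h) = ⇑f * convolution g h := by
  ext n
  simp only [Pi.mul_apply, LSeries.convolution_def, Finset.mul_sum]
  refine Finset.sum_congr rfl fun p hp ↦ ?_
  rw [(Nat.mem_divisorsAntidiagonal.mp hp).1.symm, map_mul]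
  exact mul_mul_mul_comm ..

lemma natCast_pow_cpow (p k : ℕ) (s : ℂ) : ((p ^ k : ℕ) : ℂ) ^ s = ((p : ℂ) ^ s) ^ k := by
  induction k with
  | zero => simp
  | succ k ih => rw [pow_succ, Nat.cast_mul, natCast_mul_natCast_cpow, ih, pow_succ]

variable {f : ℕ →*₀ ℂ} (hf : ∀ n, ‖f n‖ ≤ 1) {s : ℂ}

include hf

lemma lseriesSummable_mul_of_norm_le_one {g : ℕ → ℂ} (hg : LSeriesSummable g s) :
    LSeriesSummable (⇑f * g) s := by
  refine Summable.of_norm_bounded hg.norm fun n ↦ ?_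
  refine norm_term_le s ?_
  simpa using mul_le_of_le_one_left (norm_nonneg (g n)) (hf n)

variable (hs : 1 < s.re)

include hs

lemma lseriesSummable_of_norm_le_one : LSeriesSummable (⇑f) s :=
  LSeriesSummable_of_bounded_of_one_lt_re (m := 1) (fun n _ ↦ hf n) hs

lemma abscissa_lt_of_norm_le_one : abscissaOfAbsConv (⇑f) < s.re :=
  (abscissaOfAbsConv_le_of_le_const ⟨1, fun n _ ↦ hf n⟩).trans_lt (by exact_mod_cast hs)

lemma lseries_ne_zero_of_norm_le_one : LSeries (⇑f) s ≠ 0 := by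
  have hμ : LSeriesSummable (fun n ↦ ((μ n : ℤ) : ℂ)) s := LSeriesSummable_moebius_iff.mpr hs
  have h1 : convolution 1 (fun n ↦ ((μ n : ℤ) : ℂ)) = delta := by
    rw [one_convolution_eq_zeta_convolution, ← one_eq_delta]
    simp_rw [← natCoe_apply, ← intCoe_apply, coe_mul, coe_zeta_mul_coe_moebius]
  have h2 : convolution (⇑f) (⇑f * fun n ↦ ((μ n : ℤ) : ℂ)) = delta := by
    have := mul_convolution_mul f 1 (fun n ↦ ((μ n : ℤ) : ℂ))
    rw [mul_one, h1] at this
    rw [this]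
    exact LSeries.mul_delta (map_one f)
  have h3 := LSeries_convolution' (lseriesSummable_of_norm_le_one hf hs)
    (lseriesSummable_mul_of_norm_le_one hf hμ)
  rw [h2, LSeries_delta] at h3
  exact left_ne_zero_of_mul (h3.symm.trans_ne one_ne_zero)

lemma lseries_deriv_eq_of_norm_le_one :
    deriv (LSeries (⇑f)) s = -(LSeries (⇑f * fun n ↦ ((Λ n : ℝ) : ℂ)) s * LSeries (⇑f) s) := by
  rw [LSeries_deriv (abscissa_lt_of_norm_le_one hf hs), ← LSeries_convolution'
    (lseriesSummable_mul_of_norm_le_one hf (LSeriesSummable_vonMangoldt hs))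
    (lseriesSummable_of_norm_le_one hf hs)]
  have := mul_convolution_mul f (fun n ↦ ((Λ n : ℝ) : ℂ)) 1
  rw [mul_one, convolution_vonMangoldt_const_one] at this
  rw [this]
  congr 2
  ext n
  simp [logMul, mul_comm]

lemma norm_mul_cpow_lt_one {p : ℕ} (hp : p.Prime) : ‖f p * (p : ℂ) ^ (-s)‖ < 1 := by
  rw [norm_mul, norm_natCast_cpow_of_pos hp.pos]
  have : (p : ℝ) ^ (-s).re < 1 :=
    Real.rpow_lt_one_of_one_lt_of_neg (by exact_mod_cast hp.one_lt) (by simp; linarith)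
  exact (mul_le_of_le_one_left (by positivity) (hf p)).trans_lt this

lemma hasSum_term_prime_pow {p : ℕ} (hp : p.Prime) :
    HasSum (fun k : ℕ ↦ term (⇑f * fun n ↦ ((Λ n : ℝ) : ℂ)) s (p ^ (k + 1)))
      ((Real.log p : ℂ) * (f p / ((p : ℂ) ^ s - f p))) := by
  have hp0 : (p : ℂ) ≠ 0 := by exact_mod_cast hp.ne_zero
  set x := f p * (p : ℂ) ^ (-s) with hx
  have hx1 : ‖x‖ < 1 := norm_mul_cpow_lt_one hf hs hp
  have hps : (p : ℂ) ^ s ≠ 0 := by simp [cpow_eq_zero_iff, hp0]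
  have hx' : f p = x * (p : ℂ) ^ s := by
    rw [hx, cpow_neg]
    field_simp
  have h1x : 1 - x ≠ 0 := by
    intro h
    rw [← sub_eq_zero.mp h] at hx1
    simp at hx1
  have h2 : (p : ℂ) ^ s - x * (p : ℂ) ^ s ≠ 0 := by
    rw [← one_sub_mul]
    exact mul_ne_zero h1x hps
  convert! ((hasSum_geometric_of_norm_lt_one hx1).mul_left x).mul_left (Real.log p : ℂ) using 1
  · ext k
    rw [term_of_ne_zero (pow_ne_zero _ hp.ne_zero), Pi.mul_apply, vonMangoldt_apply_pow (by simp),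
      vonMangoldt_apply_prime hp, map_pow, ← pow_succ', hx, mul_pow, cpow_neg, natCast_pow_cpow,
      inv_pow]
    ring
  · rw [hx']
    field_simp

lemma hasSum_primes_lseries_vonMangoldt :
    HasSum (fun p : Nat.Primes ↦ (Real.log p : ℂ) * (f p / ((p : ℂ) ^ s - f p)))
      (LSeries (⇑f * fun n ↦ ((Λ n : ℝ) : ℂ)) s) := by
  have hsum : LSeriesSummable (⇑f * fun n ↦ ((Λ n : ℝ) : ℂ)) s :=
    lseriesSummable_mul_of_norm_le_one hf (LSeriesSummable_vonMangoldt hs)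
  have hsupp : Function.support (term (⇑f * fun n ↦ ((Λ n : ℝ) : ℂ)) s) ⊆ {n | IsPrimePow n} := by
    intro n hn
    by_contra h
    refine hn ?_
    rcases eq_or_ne n 0 with rfl | h0
    · simp
    · simp [term_of_ne_zero h0, vonMangoldt_apply, show ¬ IsPrimePow n from h]
  have h1 := (hasSum_subtype_iff_of_support_subset hsupp).mpr hsum.hasSum
  replace h1 := (Equiv.hasSum_iff Nat.Primes.prodNatEquiv).mpr h1
  refine HasSum.prod_fiberwise h1 fun p ↦ ?_
  convert! hasSum_term_prime_pow hf hs p.2 using 1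

end CompletelyMultiplicative

section EulerProducts

open LSeries Complex

/-- The indicator function of the positive integers all of whose prime factors satisfy `P`. -/
noncomputable def primeIndicator (P : ℕ → Prop) : ℕ →*₀ ℂ where
  toFun n := if n ≠ 0 ∧ ∀ p : ℕ, p.Prime → p ∣ n → P p then 1 else 0
  map_zero' := by simp
  map_one' := by
    rw [if_pos]
    exact ⟨one_ne_zero, fun p hp h ↦ absurd (Nat.dvd_one.mp h) hp.ne_one⟩
  map_mul' m n := by
    have : (m * n ≠ 0 ∧ ∀ p : ℕ, p.Prime → p ∣ m * n → P p) ↔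
        (m ≠ 0 ∧ ∀ p : ℕ, p.Prime → p ∣ m → P p) ∧ (n ≠ 0 ∧ ∀ p : ℕ, p.Prime → p ∣ n → P p) := by
      constructor
      · rintro ⟨h0, h⟩
        exact ⟨⟨left_ne_zero_of_mul h0, fun p hp hd ↦ h p hp (hd.mul_right _)⟩,
          ⟨right_ne_zero_of_mul h0, fun p hp hd ↦ h p hp (hd.mul_left _)⟩⟩
      · rintro ⟨⟨hm0, hm⟩, ⟨hn0, hn⟩⟩
        exact ⟨mul_ne_zero hm0 hn0, fun p hp hd ↦ (hp.dvd_mul.mp hd).elim (hm p hp) (hn p hp)⟩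
    simp only [this, ite_zero_mul_ite_zero, mul_one]

lemma primeIndicator_apply_prime (P : ℕ → Prop) {p : ℕ} (hp : p.Prime) :
    primeIndicator P p = if P p then 1 else 0 := by
  change (if p ≠ 0 ∧ ∀ q : ℕ, q.Prime → q ∣ p → P q then (1 : ℂ) else 0) = _
  congr 1
  refine propext ⟨fun h ↦ h.2 p hp dvd_rfl, fun h ↦ ⟨hp.ne_zero, fun q hq hd ↦ ?_⟩⟩
  rwa [(Nat.prime_dvd_prime_iff_eq hq hp).mp hd]

lemma norm_primeIndicator_le_one (P : ℕ → Prop) (n : ℕ) : ‖primeIndicator P n‖ ≤ 1 := by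
  change ‖if n ≠ 0 ∧ ∀ q : ℕ, q.Prime → q ∣ n → P q then (1 : ℂ) else 0‖ ≤ 1
  split_ifs <;> simp

/-- The Euler product of a bounded multiplicative function. -/
lemma hasProd_lseries {g : ℕ → ℂ} (h0 : g 0 = 0) (h1 : g 1 = 1)
    (hmul : ∀ {m n : ℕ}, m.Coprime n → g (m * n) = g m * g n) (hg : ∀ n, ‖g n‖ ≤ 1)
    {s : ℂ} (hs : 1 < s.re) :
    HasProd (fun p : Nat.Primes ↦ ∑' e : ℕ, g ((p : ℕ) ^ e) * ((p : ℂ) ^ (-s)) ^ e)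
      (LSeries g s) := by
  have hsum : LSeriesSummable g s :=
    LSeriesSummable_of_bounded_of_one_lt_re (m := 1) (fun n _ ↦ hg n) hs
  convert! EulerProduct.eulerProduct_hasProd (f := term g s) ?_ ?_ hsum.norm (by simp) using 1
  · ext p
    refine tsum_congr fun e ↦ ?_
    rw [term_def₀ h0, natCast_pow_cpow]
  · simp [h1]
  · intro m n hmn
    rw [term_def₀ h0, term_def₀ h0, term_def₀ h0, hmul hmn, Nat.cast_mul,
      natCast_mul_natCast_cpow]
    ring

lemma hasProd_lseries_of_completelyMultiplicative {f : ℕ →*₀ ℂ} (hf : ∀ n, ‖f n‖ ≤ 1)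
    {s : ℂ} (hs : 1 < s.re) :
    HasProd (fun p : Nat.Primes ↦ (1 - f p * (p : ℂ) ^ (-s))⁻¹) (LSeries (⇑f) s) := by
  convert! hasProd_lseries (map_zero f) (map_one f) (fun _ ↦ map_mul f _ _) hf hs using 1
  ext p
  rw [← tsum_geometric_of_norm_lt_one (norm_mul_cpow_lt_one hf hs p.2)]
  refine tsum_congr fun e ↦ ?_
  rw [mul_pow, map_pow]

variable (D : ℤ)

lemma mul_mem_SD_iff {m n : ℕ} (h : m.Coprime n) : m * n ∈ SD D ↔ m ∈ SD D ∧ n ∈ SD D := by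
  rcases Nat.eq_zero_or_pos m with rfl | hm
  · simp [SD]
  rcases Nat.eq_zero_or_pos n with rfl | hn
  · simp [SD]
  have key (p : ℕ) (hp : p.Prime) :
      (p ∣ m → (m * n).factorization p = m.factorization p) ∧
      (p ∣ n → (m * n).factorization p = n.factorization p) := by
    rw [Nat.factorization_mul hm.ne' hn.ne', Finsupp.add_apply]
    constructor
    · intro hd
      rw [Nat.factorization_eq_zero_of_not_dvd (n := n), add_zero]
      exact fun hd' ↦ hp.one_lt.ne' (Nat.eq_one_of_dvd_coprimes h hd hd')
    · intro hd
      rw [Nat.factorization_eq_zero_of_not_dvd (n := m), zero_add]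
      exact fun hd' ↦ hp.one_lt.ne' (Nat.eq_one_of_dvd_coprimes h hd' hd)
  constructor
  · rintro ⟨-, H⟩
    refine ⟨⟨hm, fun p hp hd ↦ ?_⟩, ⟨hn, fun p hp hd ↦ ?_⟩⟩
    · rw [← (key p hp).1 hd]
      exact H p hp (hd.mul_right _)
    · rw [← (key p hp).2 hd]
      exact H p hp (hd.mul_left _)
  · rintro ⟨⟨-, Hm⟩, ⟨-, Hn⟩⟩
    refine ⟨Nat.mul_pos hm hn, fun p hp hd ↦ ?_⟩
    rcases hp.dvd_mul.mp hd with hd | hd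
    · rw [(key p hp).1 hd]
      exact Hm p hp hd
    · rw [(key p hp).2 hd]
      exact Hn p hp hd

lemma prime_pow_mem_SD_iff {p : ℕ} (hp : p.Prime) (e : ℕ) :
    p ^ e ∈ SD D ↔ e = 0 ∨ kron D p = 1 ∨ (kron D p = -1 ∧ Even e) := by
  rcases eq_or_ne e 0 with rfl | he
  · simp only [pow_zero, true_or, iff_true]
    exact ⟨one_pos, fun q hq hd ↦ absurd (Nat.dvd_one.mp hd) hq.ne_one⟩
  · simp only [he, false_or]
    constructor
    · rintro ⟨-, H⟩
      simpa [hp.factorization_pow] using H p hp (dvd_pow_self p he)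
    · refine fun H ↦ ⟨pow_pos hp.pos _, fun q hq hd ↦ ?_⟩
      rw [(Nat.prime_dvd_prime_iff_eq hq hp).mp (hq.dvd_of_dvd_pow hd)]
      simpa [hp.factorization_pow] using H

/-- The indicator function of `S_D`, as a complex-valued function. -/
noncomputable def indicatorSD (n : ℕ) : ℂ := if n ∈ SD D then 1 else 0

lemma norm_indicatorSD_le_one (n : ℕ) : ‖indicatorSD D n‖ ≤ 1 := by
  unfold indicatorSD
  split_ifs <;> simp

lemma indicatorSD_zero : indicatorSD D 0 = 0 := by simp [indicatorSD, SD]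

/-- `L_{S_D}(s)` is the product of the Dirichlet series over integers composed of split primes
and over squares of integers composed of inert primes. -/
lemma lseries_indicatorSD {s : ℂ} (hs : 1 < s.re) :
    LSeries (indicatorSD D) s = LSeries (primeIndicator fun p ↦ kron D p = 1) s *
      LSeries (primeIndicator fun p ↦ kron D p = -1) (2 * s) := by
  have hs2 : 1 < (2 * s).re := by
    simp only [mul_re, re_ofNat, im_ofNat, zero_mul, sub_zero]
    linarith
  have h1 := hasProd_lseries_of_completelyMultiplicative
    (norm_primeIndicator_le_one fun p ↦ kron D p = 1) hs
  have h2 := hasProd_lseries_of_completelyMultiplicative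
    (norm_primeIndicator_le_one fun p ↦ kron D p = -1) hs2
  have h3 := hasProd_lseries (indicatorSD_zero D)
    (by simpa [indicatorSD] using (prime_pow_mem_SD_iff D Nat.prime_two 0).mpr (.inl rfl))
    (fun {m n} hmn ↦ by
      simp only [indicatorSD, mul_mem_SD_iff D hmn, ite_zero_mul_ite_zero, mul_one])
    (norm_indicatorSD_le_one D) hs
  refine h3.unique ?_
  convert! h1.mul h2 using 1
  ext ⟨p, hp⟩
  have hy : ‖(p : ℂ) ^ (-s)‖ < 1 := by
    simpa [primeIndicator_apply_prime _ hp] using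
      norm_mul_cpow_lt_one (norm_primeIndicator_le_one fun _ ↦ True) hs hp
  have hsq : (p : ℂ) ^ (-(2 * s)) = ((p : ℂ) ^ (-s)) ^ 2 := by
    rw [← cpow_nat_mul]
    congr 1
    push_cast
    ring
  simp only [primeIndicator_apply_prime _ hp, indicatorSD, prime_pow_mem_SD_iff D hp, hsq]
  set y := (p : ℂ) ^ (-s)
  by_cases hk : kron D p = 1
  · simp [hk, tsum_geometric_of_norm_lt_one hy]
  by_cases hk' : kron D p = -1
  · have hy2 : ‖y ^ 2‖ < 1 := by
      rw [norm_pow]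
      exact pow_lt_one₀ (norm_nonneg _) hy two_ne_zero
    have hE : HasSum (fun e : ℕ ↦ if Even e then y ^ e else 0) ((1 - y ^ 2)⁻¹ + 0) := by
      refine HasSum.even_add_odd ?_ ?_
      · convert! hasSum_geometric_of_norm_lt_one hy2 using 1
        ext k
        simp [pow_mul]
      · convert! hasSum_zero using 1
        ext k
        simp
    convert! hE.tsum_eq using 1
    · refine tsum_congr fun e ↦ ?_
      rcases eq_or_ne e 0 with rfl | he <;> simp [*]
    · simp [hk']
  · simp [hk, hk']

end EulerProducts

section LogarithmicDerivative

open LSeries Complex ArithmeticFunction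

lemma kron_eq_zero_iff (D : ℤ) {p : ℕ} (hp : p.Prime) : kron D p = 0 ↔ (p : ℤ) ∣ D := by
  unfold kron
  split_ifs with h1 h2 h3
  · simp [h1]
  · simp [h1]
  · simp [h1]
  · have := Fact.mk hp
    rw [← jacobiSym.legendreSym.to_jacobiSym, legendreSym.eq_zero_iff,
      ZMod.intCast_zmod_eq_zero_iff_dvd]

lemma kron_trichotomy (D : ℤ) (p : ℕ) :
    kron D p = 0 ∨ kron D p = 1 ∨ kron D p = -1 := by
  unfold kron
  split_ifs
  · simp
  · simp
  · simp
  · exact jacobiSym.trichotomy D p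

/-- The sum `∑ f(n) Λ(n) n⁻ˢ`. -/
noncomputable def lseriesMangoldt (f : ℕ → ℂ) (s : ℂ) : ℂ :=
  LSeries (f * fun n ↦ ((vonMangoldt n : ℝ) : ℂ)) s

variable {D : ℤ} {χ : ℕ →*₀ ℂ} {s : ℂ}

lemma lseriesMangoldt_add (hD : D ≠ 0) (hχ : ∀ n, ‖χ n‖ ≤ 1)
    (hχp : ∀ p : ℕ, p.Prime → χ p = kron D p) (hs : 1 < s.re) :
    lseriesMangoldt (primeIndicator fun _ ↦ True) s + lseriesMangoldt χ s =
      2 * lseriesMangoldt (primeIndicator fun p ↦ kron D p = 1) s +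
      2 * lseriesMangoldt (primeIndicator fun p ↦ kron D p = -1) (2 * s) +
      ∑ p ∈ D.natAbs.primeFactors, (Real.log p : ℂ) / ((p : ℂ) ^ s - 1) := by
  have hs2 : 1 < (2 * s).re := by
    simp only [mul_re, re_ofNat, im_ofNat, zero_mul, sub_zero]
    linarith
  have hZ := hasSum_primes_lseries_vonMangoldt (norm_primeIndicator_le_one fun _ ↦ True) hs
  have hX := hasSum_primes_lseries_vonMangoldt hχ hs
  have hA := hasSum_primes_lseries_vonMangoldt
    (norm_primeIndicator_le_one fun p ↦ kron D p = 1) hs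
  have hI := hasSum_primes_lseries_vonMangoldt
    (norm_primeIndicator_le_one fun p ↦ kron D p = -1) hs2
  have hR : HasSum (fun p : Nat.Primes ↦
      if kron D p = 0 then (Real.log p : ℂ) / ((p : ℂ) ^ s - 1) else 0)
      (∑ p ∈ D.natAbs.primeFactors, (Real.log p : ℂ) / ((p : ℂ) ^ s - 1)) := by
    set F : ℕ → ℂ := fun p ↦
      if p ∈ D.natAbs.primeFactors then (Real.log p : ℂ) / ((p : ℂ) ^ s - 1) else 0 with hF
    have h1 : HasSum F (∑ p ∈ D.natAbs.primeFactors, F p) :=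
      hasSum_sum_of_ne_finset_zero fun p hp ↦ if_neg hp
    have h2 : Function.support F ⊆ {p | p.Prime} := fun p hp ↦ by
      by_contra h
      exact hp (if_neg fun h' ↦ h (Nat.prime_of_mem_primeFactors h'))
    convert! (hasSum_subtype_iff_of_support_subset h2).mpr h1 using 1
    · ext ⟨p, hp⟩
      have : kron D p = 0 ↔ p ∈ D.natAbs.primeFactors := by
        rw [kron_eq_zero_iff D hp, Int.natCast_dvd]
        simp [hp, hD]
      simp only [this, hF, Function.comp_apply]
    · exact Finset.sum_congr rfl fun p hp ↦ (if_pos hp).symm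
  refine (hZ.add hX).unique ?_
  convert! ((hA.mul_left 2).add (hI.mul_left 2)).add hR using 1
  ext ⟨p, hp⟩
  have hnorm : 1 < ‖(p : ℂ) ^ s‖ := by
    rw [norm_natCast_cpow_of_pos hp.pos]
    exact Real.one_lt_rpow (by exact_mod_cast hp.one_lt) (by linarith)
  simp only [primeIndicator_apply_prime _ hp, hχp p hp, cpow_ofNat_mul]
  set y := (p : ℂ) ^ s
  have h1 : y - 1 ≠ 0 := by
    intro h
    rw [sub_eq_zero.mp h] at hnorm
    simp at hnorm
  have h2 : y + 1 ≠ 0 := by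
    intro h
    rw [eq_neg_of_add_eq_zero_left h] at hnorm
    simp at hnorm
  have h3 : y ^ 2 - 1 ≠ 0 := by
    rw [show y ^ 2 - 1 = (y - 1) * (y + 1) by ring]
    exact mul_ne_zero h1 h2
  rcases kron_trichotomy D p with hk | hk | hk
  · simp [hk, div_eq_mul_inv]
  · simp [hk]
    ring
  · simp [hk]
    field_simp
    ring

lemma deriv_lseries_div {f : ℕ →*₀ ℂ} (hf : ∀ n, ‖f n‖ ≤ 1) (hs : 1 < s.re) :
    deriv (LSeries f) s / LSeries f s = -lseriesMangoldt f s := by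
  rw [lseries_deriv_eq_of_norm_le_one hf hs, neg_div,
    mul_div_cancel_right₀ _ (lseries_ne_zero_of_norm_le_one hf hs), lseriesMangoldt]

lemma hasDerivAt_lseries {f : ℕ → ℂ} (hf : ∀ n, ‖f n‖ ≤ 1) (hs : 1 < s.re) :
    HasDerivAt (LSeries f) (deriv (LSeries f) s) s := by
  have h : abscissaOfAbsConv f < s.re :=
    (abscissaOfAbsConv_le_of_le_const ⟨1, fun n _ ↦ hf n⟩).trans_lt (by exact_mod_cast hs)
  exact (LSeries_hasDerivAt h).differentiableAt.hasDerivAt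

lemma deriv_lseries_indicatorSD_div (D : ℤ) (hs : 1 < s.re) :
    deriv (LSeries (indicatorSD D)) s / LSeries (indicatorSD D) s =
      -lseriesMangoldt (primeIndicator fun p ↦ kron D p = 1) s -
      2 * lseriesMangoldt (primeIndicator fun p ↦ kron D p = -1) (2 * s) := by
  have hs2 : 1 < (2 * s).re := by
    simp only [mul_re, re_ofNat, im_ofNat, zero_mul, sub_zero]
    linarith
  set f := primeIndicator fun p ↦ kron D p = 1
  set g := primeIndicator fun p ↦ kron D p = -1
  have hf : ∀ n, ‖f n‖ ≤ 1 := norm_primeIndicator_le_one _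
  have hg : ∀ n, ‖g n‖ ≤ 1 := norm_primeIndicator_le_one _
  have hev : LSeries (indicatorSD D) =ᶠ[nhds s] fun z ↦ LSeries f z * LSeries g (2 * z) := by
    filter_upwards [(isOpen_lt continuous_const continuous_re).mem_nhds hs] with z hz
    exact lseries_indicatorSD D hz
  have h1 := hasDerivAt_lseries hf hs
  have h2 : HasDerivAt (fun z ↦ LSeries g (2 * z)) (deriv (LSeries g) (2 * s) * 2) s := by
    refine HasDerivAt.comp s (h := fun z ↦ 2 * z) (hasDerivAt_lseries hg hs2) ?_
    simpa using (hasDerivAt_id s).const_mul 2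
  rw [hev.deriv_eq, (h1.fun_mul h2).deriv, hev.eq_of_nhds, ← deriv_lseries_div hf hs,
    sub_eq_add_neg, ← mul_neg, ← deriv_lseries_div hg hs2]
  have hf0 := lseries_ne_zero_of_norm_le_one hf hs
  have hg0 := lseries_ne_zero_of_norm_le_one hg hs2
  field_simp

/-- The logarithmic derivative of `L_{S_D}` in terms of those of `ζ` and `L(·, χ_D)`. -/
lemma two_mul_deriv_lseries_indicatorSD_div (hD : D ≠ 0) (hχ : ∀ n, ‖χ n‖ ≤ 1)
    (hχp : ∀ p : ℕ, p.Prime → χ p = kron D p) (hs : 1 < s.re) :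
    2 * (deriv (LSeries (indicatorSD D)) s / LSeries (indicatorSD D) s) =
      deriv riemannZeta s / riemannZeta s + deriv (LSeries χ) s / LSeries χ s -
      2 * lseriesMangoldt (primeIndicator fun p ↦ kron D p = -1) (2 * s) +
      ∑ p ∈ D.natAbs.primeFactors, (Real.log p : ℂ) / ((p : ℂ) ^ s - 1) := by
  have hζ (z : ℂ) (hz : 1 < z.re) : LSeries (primeIndicator fun _ ↦ True) z = riemannZeta z := by
    rw [← LSeries_one_eq_riemannZeta hz]
    refine LSeries_congr (fun {n} hn ↦ ?_) z
    simp [primeIndicator, hn]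
  have hev : riemannZeta =ᶠ[nhds s] LSeries (primeIndicator fun _ ↦ True) := by
    filter_upwards [(isOpen_lt continuous_const continuous_re).mem_nhds hs] with z hz
    exact (hζ z hz).symm
  rw [hev.deriv_eq, hev.eq_of_nhds, deriv_lseries_div (norm_primeIndicator_le_one _) hs,
    deriv_lseries_div hχ hs, deriv_lseries_indicatorSD_div D hs]
  linear_combination lseriesMangoldt_add hD hχ hχp hs

end LogarithmicDerivative

section DirichletTest

/-- Summation by parts: tails of a series with bounded partial sums and antitone weights. -/
lemma abs_sum_Ico_mul_le {a f : ℕ → ℝ} {B : ℝ} (hB : ∀ n, |∑ i ∈ Finset.range n, a i| ≤ B)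
    {m n : ℕ} (hmn : m ≤ n) (hf0 : ∀ i ≥ m, 0 ≤ f i) (hf : ∀ i ≥ m, f (i + 1) ≤ f i) :
    |∑ i ∈ Finset.Ico m n, a i * f i| ≤ 2 * B * f m := by
  have hQ (k : ℕ) (hk : m ≤ k) : |∑ i ∈ Finset.Ico m k, a i| ≤ 2 * B := by
    rw [Finset.sum_Ico_eq_sub _ hk]
    exact (abs_sub _ _).trans (by linarith [hB k, hB m])
  have key : |∑ i ∈ Finset.Ico m n, a i * f i - (∑ i ∈ Finset.Ico m n, a i) * f n| ≤
      2 * B * (f m - f n) := by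
    induction n, hmn using Nat.le_induction with
    | base => simp
    | succ n hmn ih =>
      rw [Finset.sum_Ico_succ_top hmn, Finset.sum_Ico_succ_top hmn]
      have h1 := hQ (n + 1) (by omega)
      rw [Finset.sum_Ico_succ_top hmn] at h1
      have h2 := hf n hmn
      set S := ∑ i ∈ Finset.Ico m n, a i * f i
      set Q := ∑ i ∈ Finset.Ico m n, a i
      calc |S + a n * f n - (Q + a n) * f (n + 1)|
          = |(S - Q * f n) + (Q + a n) * (f n - f (n + 1))| := by ring_nf
        _ ≤ |S - Q * f n| + |(Q + a n) * (f n - f (n + 1))| := abs_add_le _ _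
        _ ≤ 2 * B * (f m - f n) + 2 * B * (f n - f (n + 1)) := by
          rw [abs_mul, abs_of_nonneg (sub_nonneg.mpr h2)]
          gcongr
        _ = 2 * B * (f m - f (n + 1)) := by ring
  have h1 : |(∑ i ∈ Finset.Ico m n, a i) * f n| ≤ 2 * B * f n := by
    rw [abs_mul, abs_of_nonneg (hf0 n hmn)]
    exact mul_le_mul_of_nonneg_right (hQ n hmn) (hf0 n hmn)
  have h2 := abs_add_le (∑ i ∈ Finset.Ico m n, a i * f i - (∑ i ∈ Finset.Ico m n, a i) * f n)
    ((∑ i ∈ Finset.Ico m n, a i) * f n)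
  rw [sub_add_cancel] at h2
  linarith

/-- A uniform Dirichlet test, for weights depending continuously on a parameter. -/
lemma exists_continuousOn_tendsto_sum {X : Type*} [TopologicalSpace X] {S : Set X}
    {a : ℕ → ℝ} {B : ℝ} (hB : ∀ n, |∑ i ∈ Finset.range n, a i| ≤ B)
    {f : ℕ → X → ℝ} {g : ℕ → ℝ} {M : ℕ} (hcont : ∀ n, ContinuousOn (f n) S)
    (hf0 : ∀ n, ∀ s ∈ S, 0 ≤ f n s) (hf : ∀ n ≥ M, ∀ s ∈ S, f (n + 1) s ≤ f n s)
    (hfg : ∀ n, ∀ s ∈ S, f n s ≤ g n) (hg : Tendsto g atTop (nhds 0)) :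
    ∃ G : X → ℝ, ContinuousOn G S ∧
      ∀ s ∈ S, Tendsto (fun n ↦ ∑ i ∈ Finset.range n, a i * f i s) atTop (nhds (G s)) := by
  have hB0 : 0 ≤ B := (abs_nonneg _).trans (hB 0)
  have htail (m n : ℕ) (hm : M ≤ m) (hmn : m ≤ n) (s : X) (hs : s ∈ S) :
      dist (∑ i ∈ Finset.range m, a i * f i s) (∑ i ∈ Finset.range n, a i * f i s) ≤
        2 * B * g m := by
    rw [dist_comm, Real.dist_eq, ← Finset.sum_Ico_eq_sub _ hmn]
    refine (abs_sum_Ico_mul_le hB hmn (fun i _ ↦ hf0 i s hs)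
      (fun i hi ↦ hf i (hm.trans hi) s hs)).trans ?_
    gcongr
    exact hfg m s hs
  have hC : UniformCauchySeqOn (fun n s ↦ ∑ i ∈ Finset.range n, a i * f i s) atTop S := by
    rw [Metric.uniformCauchySeqOn_iff]
    intro ε hε
    have hlim : Tendsto (fun m ↦ 2 * B * g m) atTop (nhds 0) := by simpa using hg.const_mul (2 * B)
    obtain ⟨N, hN⟩ := eventually_atTop.mp (hlim.eventually_lt_const hε)
    refine ⟨max M N, fun m hm n hn s hs ↦ ?_⟩
    rcases le_total m n with h | h
    · exact (htail m n (by omega) h s hs).trans_lt (hN m (by omega))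
    · rw [dist_comm]
      exact (htail n m (by omega) h s hs).trans_lt (hN n (by omega))
  have hlim (s : X) (hs : s ∈ S) :
      ∃ l, Tendsto (fun n ↦ ∑ i ∈ Finset.range n, a i * f i s) atTop (nhds l) :=
    cauchySeq_tendsto_of_complete (hC.cauchySeq hs)
  choose! G hG using hlim
  refine ⟨G, ?_, hG⟩
  refine (hC.tendstoUniformlyOn_of_tendsto hG).continuousOn (Frequently.of_forall fun n ↦ ?_)
  exact continuousOn_finsetSum _ fun i _ ↦ continuousOn_const.mul (hcont i)

lemma continuousOn_natCast_rpow_neg (n : ℕ) :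
    ContinuousOn (fun s : ℝ ↦ (n : ℝ) ^ (-s)) (Set.Icc 1 2) := by
  rcases Nat.eq_zero_or_pos n with rfl | hn
  · refine (continuousOn_const (c := (0 : ℝ))).congr fun s hs ↦ ?_
    simp only
    rw [Nat.cast_zero, Real.zero_rpow (by linarith [hs.1])]
  · have : (n : ℝ) ≠ 0 := by positivity
    exact (continuous_const.rpow continuous_neg fun _ ↦ .inl this).continuousOn

lemma natCast_rpow_neg_le_inv (n : ℕ) {s : ℝ} (hs : 1 ≤ s) : (n : ℝ) ^ (-s) ≤ (n : ℝ)⁻¹ := by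
  rcases Nat.eq_zero_or_pos n with rfl | hn
  · rw [Nat.cast_zero, Real.zero_rpow (by linarith), inv_zero]
  · rw [← Real.rpow_neg_one]
    exact Real.rpow_le_rpow_of_exponent_le (by exact_mod_cast hn) (by linarith)

lemma log_mul_rpow_neg_succ_le {n : ℕ} (hn : 3 ≤ n) {s : ℝ} (hs : 1 ≤ s) :
    Real.log (n + 1 : ℕ) * ((n + 1 : ℕ) : ℝ) ^ (-s) ≤ Real.log n * (n : ℝ) ^ (-s) := by
  have hn3 : (3 : ℝ) ≤ n := by exact_mod_cast hn
  have he : Real.exp 1 ≤ n := Real.exp_one_lt_three.le.trans hn3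
  have h1 : Real.log (n + 1 : ℕ) / (n + 1 : ℕ) ≤ Real.log n / n := by
    push_cast
    exact Real.log_div_self_antitoneOn he (he.trans (by linarith)) (by linarith)
  have h2 : ((n + 1 : ℕ) : ℝ) ^ (-(s - 1)) ≤ (n : ℝ) ^ (-(s - 1)) :=
    Real.rpow_le_rpow_of_nonpos (by linarith) (by push_cast; linarith) (by linarith)
  have h3 (k : ℕ) (hk : 0 < k) :
      Real.log k * (k : ℝ) ^ (-s) = Real.log k / k * (k : ℝ) ^ (-(s - 1)) := by
    have hk' : (k : ℝ) ≠ 0 := by positivity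
    rw [show -(s - 1) = -s + 1 by ring, Real.rpow_add_one hk']
    field_simp
  rw [h3 n (by omega), h3 (n + 1) (by omega)]
  exact mul_le_mul h1 h2 (by positivity) (div_nonneg (Real.log_natCast_nonneg n) (by positivity))

variable {a : ℕ → ℝ} {B : ℝ} (hB : ∀ n, |∑ i ∈ Finset.range n, a i| ≤ B)

include hB

lemma exists_continuousOn_dirichletSeries :
    ∃ G : ℝ → ℝ, ContinuousOn G (Set.Icc 1 2) ∧ ∀ s ∈ Set.Icc (1 : ℝ) 2,
      Tendsto (fun n ↦ ∑ i ∈ Finset.range n, a i * (i : ℝ) ^ (-s)) atTop (nhds (G s)) := by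
  refine exists_continuousOn_tendsto_sum (f := fun (n : ℕ) (s : ℝ) ↦ (n : ℝ) ^ (-s)) hB (M := 1)
    (g := fun n ↦ (n : ℝ)⁻¹) continuousOn_natCast_rpow_neg
    (fun n s _ ↦ by positivity) (fun n hn s hs ↦ ?_)
    (fun n s hs ↦ natCast_rpow_neg_le_inv n hs.1) tendsto_inv_atTop_nhds_zero_nat
  exact Real.rpow_le_rpow_of_nonpos (by exact_mod_cast hn) (by push_cast; linarith)
    (by linarith [hs.1])

lemma exists_continuousOn_log_dirichletSeries :
    ∃ G : ℝ → ℝ, ContinuousOn G (Set.Icc 1 2) ∧ ∀ s ∈ Set.Icc (1 : ℝ) 2,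
      Tendsto (fun n ↦ ∑ i ∈ Finset.range n, a i * (Real.log i * (i : ℝ) ^ (-s))) atTop
        (nhds (G s)) := by
  refine exists_continuousOn_tendsto_sum (f := fun (n : ℕ) (s : ℝ) ↦ Real.log n * (n : ℝ) ^ (-s))
    hB (M := 3) (g := fun n ↦ Real.log n / n)
    (fun n ↦ continuousOn_const.mul (continuousOn_natCast_rpow_neg n))
    (fun n s _ ↦ mul_nonneg (Real.log_natCast_nonneg n) (by positivity))
    (fun n hn s hs ↦ log_mul_rpow_neg_succ_le hn hs.1)
    (fun n s hs ↦ ?_) ?_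
  · exact mul_le_mul_of_nonneg_left (natCast_rpow_neg_le_inv n hs.1) (Real.log_natCast_nonneg n)
  · exact (Real.isLittleO_log_id_atTop.tendsto_div_nhds_zero).comp tendsto_natCast_atTop_atTop

end DirichletTest

section Character

open scoped NumberTheorySymbols

variable {D : ℤ} {χ : ℕ → ℤ}

lemma IsChiD.map_mul (hχ : IsChiD D χ) (m n : ℕ) : χ (m * n) = χ m * χ n := hχ.2.2.1 m n

lemma kron_eq_jacobiSym (D : ℤ) {p : ℕ} (hp : p.Prime) (h2 : p ≠ 2) : kron D p = J(D | p) := by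
  unfold kron
  split_ifs with h
  · have := Fact.mk hp
    rw [← jacobiSym.legendreSym.to_jacobiSym, eq_comm, legendreSym.eq_zero_iff,
      ZMod.intCast_zmod_eq_zero_iff_dvd]
    exact h
  · rfl

lemma IsChiD.eq_jacobiSym_of_odd (hχ : IsChiD D χ) {n : ℕ} (hn : Odd n) : χ n = J(D | n) := by
  induction n using Nat.recOnMul with
  | zero => exact absurd hn (by decide)
  | one => rw [hχ.2.1, jacobiSym.one_right]
  | prime p hp =>
    rw [hχ.2.2.2 p hp, kron_eq_jacobiSym D hp (by rintro rfl; exact absurd hn (by decide))]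
  | mul a b iha ihb =>
    obtain ⟨ha, hb⟩ := Nat.odd_mul.mp hn
    have : NeZero a := ⟨ha.pos.ne'⟩
    have : NeZero b := ⟨hb.pos.ne'⟩
    rw [hχ.map_mul, iha ha, ihb hb, jacobiSym.mul_right]

lemma jacobiSym_neg_eq_of_three_mod_four {m p : ℕ} (hm : m % 4 = 3) (hp : Odd p) :
    J(-(m : ℤ) | p) = J(p | m) := by
  rw [jacobiSym.neg _ hp,
    ← jacobiSym.quadratic_reciprocity_if (a := m) (by omega) (Nat.odd_iff.mp hp)]
  rcases Nat.odd_mod_four_iff.mp (Nat.odd_iff.mp hp) with h | h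
  · rw [ZMod.χ₄_nat_one_mod_four h, if_neg (by omega), one_mul]
  · rw [ZMod.χ₄_nat_three_mod_four h, if_pos ⟨hm, h⟩, neg_one_mul, neg_neg]

lemma IsChiD.eq_jacobiSym (hχ : IsChiD D χ) (hD : D ≤ -3) (h4 : D % 4 = 1) (n : ℕ) :
    χ n = J(n | D.natAbs) := by
  have hodd : Odd D.natAbs := Nat.odd_iff.mpr (by omega)
  induction n using Nat.recOnMul with
  | zero => rw [hχ.1, Nat.cast_zero, jacobiSym.zero_left (by omega)]
  | one => rw [hχ.2.1, Nat.cast_one, jacobiSym.one_left]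
  | prime p hp =>
    rcases hp.eq_two_or_odd' with rfl | hp2
    · have h2 : ¬ ((2 : ℕ) : ℤ) ∣ D := by omega
      have h2' : ¬ D.natAbs % 2 = 0 := by omega
      rw [hχ.2.2.2 2 hp, Nat.cast_ofNat, jacobiSym.at_two hodd, ZMod.χ₈_nat_eq_if_mod_eight,
        kron, if_neg h2, if_pos rfl, if_neg h2']
      exact if_congr (by omega) rfl rfl
    · rw [hχ.eq_jacobiSym_of_odd hp2]
      conv_lhs => rw [show D = -(D.natAbs : ℤ) by omega]
      exact jacobiSym_neg_eq_of_three_mod_four (by omega) hp2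
  | mul a b iha ihb => rw [hχ.map_mul, iha, ihb, Nat.cast_mul, jacobiSym.mul_left]

lemma IsChiD.apply_eq_zero (hχ : IsChiD D χ) {p n : ℕ} (hp : p.Prime) (hpD : (p : ℤ) ∣ D)
    (hpn : p ∣ n) : χ n = 0 := by
  obtain ⟨k, rfl⟩ := hpn
  rw [hχ.map_mul, hχ.2.2.2 p hp, kron, if_pos hpD, zero_mul]

lemma IsChiD.apply_mod (hχ : IsChiD D χ) (hD : D ≤ -3) (hfund : IsFundamentalDiscriminant D)
    (n : ℕ) : χ (n % D.natAbs) = χ n := by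
  rcases hfund with ⟨h4, -⟩ | ⟨m, rfl, -, -⟩
  · rw [hχ.eq_jacobiSym hD h4, hχ.eq_jacobiSym hD h4, jacobiSym.mod_left (n : ℤ), Int.natCast_mod]
  · have hN : (4 * m).natAbs = 4 * m.natAbs := by omega
    have hpar : n % (4 * m).natAbs % 2 = n % 2 := by
      rw [hN, Nat.mod_mod_of_dvd]
      exact ⟨2 * m.natAbs, by ring⟩
    rcases Nat.even_or_odd n with hn | hn
    · have h2 : ((2 : ℕ) : ℤ) ∣ 4 * m := ⟨2 * m, by push_cast; ring⟩
      rw [hχ.apply_eq_zero Nat.prime_two h2 hn.two_dvd, hχ.apply_eq_zero Nat.prime_two h2]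
      exact Nat.dvd_of_mod_eq_zero (hpar.trans (Nat.even_iff.mp hn))
    · have hn' : Odd (n % (4 * m).natAbs) := Nat.odd_iff.mpr (hpar.trans (Nat.odd_iff.mp hn))
      rw [hχ.eq_jacobiSym_of_odd hn, hχ.eq_jacobiSym_of_odd hn', jacobiSym.mul_left,
        jacobiSym.mul_left, jacobiSym.at_four hn, jacobiSym.at_four hn', hN,
        ← jacobiSym.mod_right m hn]

lemma IsChiD.exists_eq_neg_one (hχ : IsChiD D χ) (hD : D ≤ -3) : ∃ n, χ n = -1 := by
  set n := 4 * D.natAbs - 1 with hn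
  have hn4 : n % 4 = 3 := by omega
  have hodd : Odd n := Nat.odd_iff.mpr (by omega)
  refine ⟨n, ?_⟩
  have h1 : J((D.natAbs : ℤ) | n) = 1 := by
    rw [← one_mul J((D.natAbs : ℤ) | n), ← jacobiSym.at_four hodd, ← jacobiSym.mul_left,
      show 4 * (D.natAbs : ℤ) = 1 + n by omega, jacobiSym.mod_left, Int.add_emod_right,
      ← jacobiSym.mod_left, jacobiSym.one_left, jacobiSym.at_four hodd]
  rw [hχ.eq_jacobiSym_of_odd hodd, show D = -(D.natAbs : ℤ) by omega, jacobiSym.neg _ hodd,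
    ZMod.χ₄_nat_three_mod_four hn4, h1, mul_one]

/-- `χ_D` is a Dirichlet character modulo `|D|`. -/
lemma IsChiD.exists_dirichletCharacter (hχ : IsChiD D χ) (hD : D ≤ -3)
    (hfund : IsFundamentalDiscriminant D) :
    ∃ ψ : DirichletCharacter ℂ D.natAbs, ψ ≠ 1 ∧ ∀ n : ℕ, ψ n = χ n := by
  have : NeZero D.natAbs := ⟨by omega⟩
  let ψ : DirichletCharacter ℂ D.natAbs :=
    { toFun := fun a ↦ (χ a.val : ℂ)
      map_one' := by
        have h := hχ.apply_mod hD hfund 1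
        rw [Nat.mod_eq_of_lt (by omega)] at h
        rw [← Nat.cast_one, ZMod.val_natCast, hχ.apply_mod hD hfund, hχ.2.1, Int.cast_one]
      map_mul' := fun a b ↦ by
        rw [ZMod.val_mul, hχ.apply_mod hD hfund, hχ.map_mul, Int.cast_mul]
      map_nonunit' := fun a ha ↦ by
        rw [← ZMod.natCast_zmod_val a, ZMod.isUnit_iff_coprime, Nat.Prime.not_coprime_iff_dvd] at ha
        obtain ⟨p, hp, h1, h2⟩ := ha
        simp [hχ.apply_eq_zero hp (Int.natCast_dvd.mpr h2) h1] }
  have hψ (n : ℕ) : ψ n = χ n := by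
    change ((χ (n : ZMod D.natAbs).val : ℤ) : ℂ) = _
    rw [ZMod.val_natCast, hχ.apply_mod hD hfund]
  refine ⟨ψ, fun h ↦ ?_, hψ⟩
  obtain ⟨n, hn⟩ := hχ.exists_eq_neg_one hD
  have h1 := hψ n
  rw [h, hn] at h1
  by_cases hu : IsUnit (n : ZMod D.natAbs)
  · rw [MulChar.one_apply hu] at h1
    norm_num at h1
  · rw [MulChar.map_nonunit _ hu] at h1
    norm_num at h1

/-- The partial sums of a nontrivial Dirichlet character are bounded. -/
lemma DirichletCharacter.exists_norm_sum_range_le {N : ℕ} [NeZero N] {ψ : DirichletCharacter ℂ N}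
    (hψ : ψ ≠ 1) : ∃ B : ℝ, ∀ n, ‖∑ i ∈ Finset.range n, ψ i‖ ≤ B := by
  have hper : Function.Periodic (fun n ↦ ∑ i ∈ Finset.range n, ψ (i : ZMod N)) N := by
    intro n
    simp only
    rw [Finset.sum_range_add, add_eq_left, ← MulChar.sum_eq_zero_of_ne_one hψ,
      ← Equiv.sum_comp (Equiv.addLeft (n : ZMod N))]
    refine Finset.sum_bij' (fun i _ ↦ (i : ZMod N)) (fun a _ ↦ a.val) (fun _ _ ↦ Finset.mem_univ _)
      (fun a _ ↦ Finset.mem_range.mpr a.val_lt) (fun i hi ↦ ?_) (fun a _ ↦ ZMod.natCast_zmod_val a)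
      (fun i _ ↦ by simp)
    rw [ZMod.val_natCast, Nat.mod_eq_of_lt (Finset.mem_range.mp hi)]
  refine ⟨N, fun n ↦ ?_⟩
  rw [← hper.map_mod_nat n]
  refine (norm_sum_le_of_le _ fun i _ ↦ ψ.norm_le_one _).trans ?_
  simpa using (Nat.mod_lt n (NeZero.pos N)).le

end Character

section Limits

open LSeries Complex

lemma term_ofReal (a : ℕ → ℝ) {s : ℝ} (hs : s ≠ 0) (n : ℕ) :
    term (fun n ↦ (a n : ℂ)) s n = ((a n * (n : ℝ) ^ (-s) : ℝ) : ℂ) := by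
  rcases eq_or_ne n 0 with rfl | hn
  · rw [term_zero, Nat.cast_zero, Real.zero_rpow (neg_ne_zero.mpr hs), mul_zero, ofReal_zero]
  · rw [term_of_ne_zero hn, ofReal_mul, ofReal_cpow n.cast_nonneg, ofReal_neg, cpow_neg,
      div_eq_mul_inv, ofReal_natCast]

lemma tendsto_sum_range_lseries {a : ℕ → ℝ} {s : ℝ} (hs : s ≠ 0)
    (h : LSeriesSummable (fun n ↦ (a n : ℂ)) s) :
    Tendsto (fun N ↦ ((∑ n ∈ Finset.range N, a n * (n : ℝ) ^ (-s) : ℝ) : ℂ)) atTop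
      (nhds (LSeries (fun n ↦ (a n : ℂ)) s)) := by
  simpa only [LSeries, ofReal_sum, term_ofReal a hs] using h.hasSum.tendsto_sum_nat

lemma ofReal_eq_of_continuousOn {G : ℝ → ℝ} {F : ℂ → ℂ} (hG : ContinuousOn G (Set.Icc 1 2))
    (hF : Continuous F) (h : ∀ s : ℝ, 1 < s → s ≤ 2 → (G s : ℂ) = F s) : (G 1 : ℂ) = F 1 := by
  have h1 : Tendsto (fun s : ℝ ↦ (G s : ℂ)) (nhdsWithin 1 (Set.Ioc 1 2)) (nhds (G 1 : ℂ)) :=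
    (continuous_ofReal.tendsto _).comp
      ((hG 1 (by norm_num)).tendsto.mono_left (nhdsWithin_mono _ Set.Ioc_subset_Icc_self))
  have h2 : Tendsto (fun s : ℝ ↦ F s) (nhdsWithin 1 (Set.Ioc 1 2)) (nhds (F 1)) := by
    have := (hF.comp continuous_ofReal).tendsto 1
    exact this.mono_left nhdsWithin_le_nhds
  have : (nhdsWithin (1 : ℝ) (Set.Ioc 1 2)).NeBot := by
    rw [nhdsWithin_Ioc_eq_nhdsGT one_lt_two]
    infer_instance
  refine tendsto_nhds_unique h1 (h2.congr' ?_)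
  filter_upwards [self_mem_nhdsWithin] with s hs
  exact (h s hs.1 hs.2).symm

/-- The series `∑ χ(n)/n` and `-∑ χ(n) log n / n` of a nontrivial real character converge to
`L(1,χ)` and `L'(1,χ)`. -/
lemma exists_tendsto_lFunction_one {N : ℕ} [NeZero N] {ψ : DirichletCharacter ℂ N} (hψ : ψ ≠ 1)
    {a : ℕ → ℝ} (ha : ∀ n : ℕ, ψ n = a n) :
    ∃ L L' : ℝ,
      Tendsto (fun N : ℕ ↦ ∑ n ∈ Finset.range N, a n / (n : ℝ)) atTop (nhds L) ∧
      Tendsto (fun N : ℕ ↦ -∑ n ∈ Finset.range N, a n * Real.log n / (n : ℝ)) atTop (nhds L') ∧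
      (L : ℂ) = DirichletCharacter.LFunction ψ 1 ∧
      (L' : ℂ) = deriv (DirichletCharacter.LFunction ψ) 1 := by
  obtain ⟨B, hB⟩ := DirichletCharacter.exists_norm_sum_range_le hψ
  have hB' (n : ℕ) : |∑ i ∈ Finset.range n, a i| ≤ B := by
    have := hB n
    simpa only [ha, ← ofReal_sum, norm_real, Real.norm_eq_abs] using this
  have hfun : (fun n : ℕ ↦ ψ n) = fun n ↦ (a n : ℂ) := funext ha
  have habs {s : ℝ} (hs : 1 < s) :
      abscissaOfAbsConv (fun n ↦ (a n : ℂ)) < ((s : ℂ).re : EReal) := by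
    rw [← hfun]
    refine (abscissaOfAbsConv_le_of_le_const ⟨1, fun n _ ↦ ψ.norm_le_one _⟩).trans_lt ?_
    rw [ofReal_re]
    exact_mod_cast hs
  obtain ⟨G, hGc, hG⟩ := exists_continuousOn_dirichletSeries hB'
  obtain ⟨G₁, hG₁c, hG₁⟩ := exists_continuousOn_log_dirichletSeries hB'
  have hdiff := DirichletCharacter.differentiable_LFunction hψ
  refine ⟨G 1, -G₁ 1, ?_, ?_, ?_, ?_⟩
  · simpa only [Real.rpow_neg_one, ← div_eq_mul_inv] using hG 1 (by norm_num)
  · simpa only [Real.rpow_neg_one, ← div_eq_mul_inv, ← mul_div_assoc] using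
      (hG₁ 1 (by norm_num)).neg
  · refine ofReal_eq_of_continuousOn hGc hdiff.continuous fun s hs hs2 ↦ ?_
    rw [DirichletCharacter.LFunction_eq_LSeries ψ (by simpa using hs), hfun]
    refine tendsto_nhds_unique ((continuous_ofReal.tendsto _).comp (hG s ⟨hs.le, hs2⟩)) ?_
    exact tendsto_sum_range_lseries (by linarith)
      (LSeriesSummable_of_abscissaOfAbsConv_lt_re (habs hs))
  · refine ofReal_eq_of_continuousOn (G := fun s ↦ -G₁ s) hG₁c.neg
      hdiff.deriv.continuous fun s hs hs2 ↦ ?_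
    have hlog : logMul (fun n ↦ (a n : ℂ)) = fun n ↦ ((a n * Real.log n : ℝ) : ℂ) := by
      ext n
      rw [logMul, ofReal_mul, natCast_log, mul_comm]
    rw [DirichletCharacter.deriv_LFunction_eq_deriv_LSeries ψ (by simpa using hs), hfun,
      LSeries_deriv (habs hs), ofReal_neg, neg_inj, hlog]
    refine tendsto_nhds_unique ((continuous_ofReal.tendsto _).comp (hG₁ s ⟨hs.le, hs2⟩)) ?_
    simp only [Function.comp_def, ← mul_assoc]
    refine tendsto_sum_range_lseries (by linarith) ?_
    rw [← hlog]
    exact LSeriesSummable_logMul_of_lt_re (habs hs)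

lemma tendsto_deriv_riemannZeta_div_add :
    Tendsto (fun s : ℂ ↦ deriv riemannZeta s / riemannZeta s + 1 / (s - 1)) (nhdsWithin 1 {1}ᶜ)
      (nhds (Real.eulerMascheroniConstant : ℂ)) := by
  have h := (Asymptotics.isLittleO_one_iff ℂ).mp log_deriv_riemannZeta_add_inv_sub_sub_isLittleO
  simpa only [one_div, sub_add_cancel, zero_add] using
    h.add_const (Real.eulerMascheroniConstant : ℂ)

lemma ofReal_lseries'_SD (D : ℤ) {s : ℝ} (hs : 1 < s) :
    (LSeries' (SD D) s : ℂ) = LSeries (indicatorSD D) s := by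
  have h : indicatorSD D = fun n ↦ ((if n ∈ SD D then 1 else 0 : ℝ) : ℂ) := by
    ext n
    simp only [indicatorSD]
    split_ifs <;> simp
  rw [LSeries', ofReal_tsum, LSeries, h]
  refine tsum_congr fun n ↦ ?_
  rw [term_ofReal _ (by linarith : s ≠ 0)]
  split_ifs <;> simp

lemma ofReal_deriv_lseries'_SD (D : ℤ) {s : ℝ} (hs : 1 < s) :
    ((deriv (LSeries' (SD D)) s : ℝ) : ℂ) = deriv (LSeries (indicatorSD D)) s := by
  have h := hasDerivAt_lseries (norm_indicatorSD_le_one D) (s := s) (by simpa using hs)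
  have hev : LSeries' (SD D) =ᶠ[nhds s] fun x : ℝ ↦ (LSeries (indicatorSD D) x).re := by
    filter_upwards [eventually_gt_nhds hs] with x hx
    rw [← ofReal_lseries'_SD D hx, ofReal_re]
  have hr := h.real_of_complex.congr_of_eventuallyEq hev
  rw [hr.deriv]
  refine hr.ofReal_comp.deriv.symm.trans ?_
  rw [← h.comp_ofReal.deriv]
  refine EventuallyEq.deriv_eq ?_
  filter_upwards [eventually_gt_nhds hs] with x hx
  rw [ofReal_lseries'_SD D hx]

/-- The value at `2` of the prime sum over the inert primes. -/
lemma hasSum_inert (D : ℤ) :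
    ∃ I : ℝ, HasSum (fun p : {p : ℕ // p.Prime ∧ kron D p = -1} ↦
        2 * Real.log p / ((p : ℝ) ^ 2 - 1)) I ∧
      2 * lseriesMangoldt (primeIndicator fun p ↦ kron D p = -1) 2 = I := by
  set g : ℕ → ℝ := fun p ↦
    if p.Prime ∧ kron D p = -1 then 2 * Real.log p / ((p : ℝ) ^ 2 - 1) else 0
  have hsum := (hasSum_primes_lseries_vonMangoldt (s := 2)
    (norm_primeIndicator_le_one fun p ↦ kron D p = -1) (by norm_num)).mul_left 2
  have hg : HasSum (fun p : Nat.Primes ↦ (g p : ℂ))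
      (2 * lseriesMangoldt (primeIndicator fun p ↦ kron D p = -1) 2) := by
    convert! hsum using 1
    ext ⟨p, hp⟩
    simp only [g, primeIndicator_apply_prime _ hp, hp, true_and, cpow_ofNat]
    split_ifs
    · push_cast [natCast_log]
      ring
    · simp
  have hs : Summable fun p : Nat.Primes ↦ g p := by
    have := hg.summable
    exact_mod_cast this
  refine ⟨_, ?_, (hg.unique (hasSum_ofReal.mpr hs.hasSum))⟩
  have h1 : HasSum g (∑' p : Nat.Primes, g p) :=
    (hasSum_subtype_iff_of_support_subset (f := g) (s := {p | p.Prime}) fun p hp ↦ by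
      by_contra h
      exact hp (if_neg fun h' ↦ h h'.1)).mp hs.hasSum
  convert! (hasSum_subtype_iff_of_support_subset (f := g)
    (s := {p | p.Prime ∧ kron D p = -1}) fun p hp ↦ by
      by_contra h
      exact hp (if_neg h)).mpr h1 using 1
  ext ⟨p, hp⟩
  exact (if_pos hp).symm

lemma continuousAt_lseriesMangoldt {f : ℕ →*₀ ℂ} (hf : ∀ n, ‖f n‖ ≤ 1) {s : ℂ} (hs : 1 < s.re) :
    ContinuousAt (lseriesMangoldt f) s := by
  have han : AnalyticAt ℂ (LSeries f) s :=
    LSeries_analyticOnNhd _ s (abscissa_lt_of_norm_le_one hf hs)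
  refine (han.deriv.div han (lseries_ne_zero_of_norm_le_one hf hs)).continuousAt.neg.congr ?_
  filter_upwards [(isOpen_lt continuous_const continuous_re).mem_nhds hs] with z hz
  rw [Pi.neg_apply, Pi.div_apply, deriv_lseries_div hf hz, neg_neg]

end Limits

/-- For a fundamental discriminant `D ≤ -3`, the Euler–Kronecker constant `γ_{S_D}`
of `S_D` (with density `1/2`) exists and
`2 γ_{S_D} = γ + (L'/L)(1,χ_D) - ∑_{(D/p) = -1} 2 log p/(p² - 1) + ∑_{p ∣ D} log p/(p-1)`,
where `L = L(1,χ_D)` and `L' = L'(1,χ_D)` are the limits of the partial sums of the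
series `∑ χ_D(n)/n` and `-∑ χ_D(n) log n / n`. -/
theorem eulerKronecker_SD (D : ℤ) (hD : D ≤ -3) (hfund : IsFundamentalDiscriminant D)
    (χD : ℕ → ℤ) (hχ : IsChiD D χD) :
    ∃ γSD L L' : ℝ,
      Tendsto (fun N : ℕ => ∑ n ∈ Finset.range N, (χD n : ℝ) / (n : ℝ)) atTop (nhds L) ∧
      Tendsto (fun N : ℕ => -∑ n ∈ Finset.range N, (χD n : ℝ) * Real.log n / (n : ℝ))
        atTop (nhds L') ∧
      IsEulerKronecker (SD D) (1 / 2) γSD ∧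
      Summable (fun p : {p : ℕ // p.Prime ∧ kron D p = -1} =>
        2 * Real.log p / ((p : ℝ) ^ 2 - 1)) ∧
      2 * γSD = Real.eulerMascheroniConstant + L' / L -
        (∑' p : {p : ℕ // p.Prime ∧ kron D p = -1}, 2 * Real.log p / ((p : ℝ) ^ 2 - 1)) +
        ∑ p ∈ D.natAbs.primeFactors, Real.log p / ((p : ℝ) - 1) := by
  have hD0 : D ≠ 0 := by omega
  have : NeZero D.natAbs := ⟨by omega⟩
  obtain ⟨ψ, hψ, hψχ⟩ := hχ.exists_dirichletCharacter hD hfund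
  obtain ⟨L, L', hL, hL', hLψ, hLψ'⟩ := exists_tendsto_lFunction_one hψ (a := fun n ↦ (χD n : ℝ))
    fun n ↦ by rw [hψχ]; simp
  obtain ⟨I, hI, hI2⟩ := hasSum_inert D
  let χ : ℕ →*₀ ℂ :=
    { toFun := fun n ↦ χD n
      map_zero' := by rw [hχ.1, Int.cast_zero]
      map_one' := by rw [hχ.2.1, Int.cast_one]
      map_mul' := fun m n ↦ by rw [hχ.map_mul, Int.cast_mul] }
  have hχψ : (⇑χ) = fun n : ℕ ↦ ψ n := funext fun n ↦ (hψχ n).symm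
  have hχ1 (n : ℕ) : ‖χ n‖ ≤ 1 := by
    rw [hχψ]
    exact ψ.norm_le_one _
  have hχp (p : ℕ) (hp : p.Prime) : χ p = kron D p := congrArg Int.cast (hχ.2.2.2 p hp)
  set R : ℝ := ∑ p ∈ D.natAbs.primeFactors, Real.log p / ((p : ℝ) - 1) with hR
  refine ⟨(Real.eulerMascheroniConstant + L' / L - I + R) / 2, L, L', hL, hL', ?_, hI.summable, ?_⟩
  · have hcast : Tendsto (fun s : ℝ ↦ (s : ℂ)) (nhdsWithin 1 (Set.Ioi 1)) (nhdsWithin 1 {1}ᶜ) := by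
      refine tendsto_nhdsWithin_iff.mpr ⟨?_, ?_⟩
      · exact (Complex.continuous_ofReal.tendsto 1).mono_left nhdsWithin_le_nhds
      · filter_upwards [self_mem_nhdsWithin] with s hs
        simpa using (ne_of_gt hs : s ≠ 1)
    have hcast' := hcast.mono_right nhdsWithin_le_nhds
    have hζ := tendsto_deriv_riemannZeta_div_add.comp hcast
    have hdiff := DirichletCharacter.differentiable_LFunction hψ
    have hψlim := ((hdiff.deriv.continuous.tendsto 1).div (hdiff.continuous.tendsto 1)
      (DirichletCharacter.LFunction_apply_one_ne_zero hψ)).comp hcast'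
    have hinert : Tendsto (fun s : ℂ ↦
        2 * lseriesMangoldt (primeIndicator fun p ↦ kron D p = -1) (2 * s)) (nhds 1)
        (nhds (I : ℂ)) := by
      rw [← hI2]
      refine Tendsto.const_mul 2 (Tendsto.comp (continuousAt_lseriesMangoldt
        (norm_primeIndicator_le_one fun p ↦ kron D p = -1) (s := 2) (by norm_num)) ?_)
      exact Continuous.tendsto' (by fun_prop) 1 2 (by norm_num)
    have hram : Tendsto (fun s : ℂ ↦
        ∑ p ∈ D.natAbs.primeFactors, (Real.log p : ℂ) / ((p : ℂ) ^ s - 1)) (nhds 1)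
        (nhds (R : ℂ)) := by
      rw [hR, Complex.ofReal_sum]
      refine tendsto_finsetSum _ fun p hp ↦ ?_
      have hp := Nat.prime_of_mem_primeFactors hp
      have hp0 : (p : ℂ) ≠ 0 := by exact_mod_cast hp.ne_zero
      have h1 : (p : ℂ) ^ (1 : ℂ) - 1 ≠ 0 := by
        rw [Complex.cpow_one, sub_ne_zero]
        exact_mod_cast hp.one_lt.ne'
      have hc : ContinuousAt (fun s : ℂ ↦ (Real.log p : ℂ) / ((p : ℂ) ^ s - 1)) 1 :=
        continuousAt_const.div
          ((continuousAt_id.const_cpow (Or.inl hp0)).sub continuousAt_const) h1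
      simpa [ContinuousAt] using hc
    have hlim := (((hζ.add hψlim).sub (hinert.comp hcast')).add (hram.comp hcast')).div_const 2
    rw [← hLψ, ← hLψ'] at hlim
    have hre := (Complex.continuous_re.tendsto _).comp hlim
    rw [IsEulerKronecker]
    convert! hre.congr' ?_ using 2
    · norm_cast
    · filter_upwards [self_mem_nhdsWithin] with s hs
      have hs1 : 1 < (s : ℂ).re := by simpa using hs
      have hkey := two_mul_deriv_lseries_indicatorSD_div hD0 hχ1 hχp hs1
      rw [hχψ, ← DirichletCharacter.deriv_LFunction_eq_deriv_LSeries ψ hs1,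
        ← DirichletCharacter.LFunction_eq_LSeries ψ hs1, ← ofReal_deriv_lseries'_SD D hs,
        ← ofReal_lseries'_SD D hs] at hkey
      rw [← Complex.ofReal_re (deriv (LSeries' (SD D)) s / _ + _)]
      simp only [Function.comp_apply, Pi.div_apply]
      congr 1
      simp only [Complex.ofReal_add, Complex.ofReal_sub, Complex.ofReal_div, Complex.ofReal_one,
        Complex.ofReal_ofNat]
      linear_combination -hkey / 2
  · rw [hI.tsum_eq]
    ring
end
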